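/- Let $\mathbf{k}$ be an algebraically closed field of characteristic $0$, $z$ transcendental over $\mathbf{k}$, $K$ a finite extension of $\mathbf{k}(z)$ of genus $g_{K/\mathbf{k}}$, and $S$ a finite set of valuations of $K/\mathbf{k}$. Then every solution of $x + y = 1$ with $x, y \in O_S^* \setminus \mathbf{k}^*$ satisfies $\max(H_K(x), H_K(y)) \le |S| + 2 g_{K/\mathbf{k}} - 2$. -/

import Mathlib

/-- A valuation of a function field `K` over the constant field `k`: a discrete
(additive, surjective onto `ℤ`) valuation of `K` that is trivial on `k`.  We use the
junk convention `v 0 = 0` (thinking of `v 0 = ∞`, which never contributes). -/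
structure FFVal (k K : Type*) [Field k] [Field K] [Algebra k K] where
  v : K → ℤ
  v_zero : v 0 = 0
  map_mul : ∀ x y : K, x ≠ 0 → y ≠ 0 → v (x * y) = v x + v y
  add_min : ∀ x y : K, x ≠ 0 → y ≠ 0 → x + y ≠ 0 → min (v x) (v y) ≤ v (x + y)
  surj : ∀ n : ℤ, ∃ x : K, x ≠ 0 ∧ v x = n
  triv : ∀ c : k, c ≠ 0 → v (algebraMap k K c) = 0

/-- The height `H_K(x) = -∑_{v ∈ M_K} min(0, v(x))` of `x ∈ K` relative to `K/k`
(a finite sum; the convention `v 0 = 0` gives `H_K(0) = 0`). -/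
noncomputable def ffHeight (k : Type*) {K : Type*} [Field k] [Field K] [Algebra k K]
    (x : K) : ℤ :=
  -∑ᶠ w : FFVal k K, min 0 (w.v x)

/-- The Riemann–Roch space `L(D) = {x ∈ K : x = 0 or v(x) ≥ -D(v) for all v}` of a
divisor `D` (a finitely supported `ℤ`-valued function on the valuations of `K/k`);
since this set is a `k`-subspace of `K`, it equals its `k`-span. -/
noncomputable def RRspace (k K : Type*) [Field k] [Field K] [Algebra k K]
    (D : FFVal k K →₀ ℤ) : Submodule k K :=
  Submodule.span k {x : K | x ≠ 0 → ∀ w : FFVal k K, -D w ≤ w.v x}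

/-- The genus of `K/k`, via Riemann's theorem: the supremum over all divisors `D` of
`deg D + 1 - ℓ(D)`, where `ℓ(D) = dim_k L(D)`. -/
noncomputable def ffGenus (k K : Type*) [Field k] [Field K] [Algebra k K] : ℤ :=
  sSup {g : ℤ | ∃ D : FFVal k K →₀ ℤ,
    g = D.sum (fun _ n => n) + 1 - (Module.finrank k (RRspace k K D) : ℤ)}

open Polynomial

theorem ff_trdeg (k K : Type*) [Field k] [Field K]
    [Algebra (RatFunc k) K] [FiniteDimensional (RatFunc k) K]
    [Algebra k K] [IsScalarTower k (RatFunc k) K] : Algebra.trdeg k K = 1 := by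
  let : Algebra k[X] K :=
    ((algebraMap (RatFunc k) K).comp (algebraMap k[X] (RatFunc k))).toAlgebra
  have : IsScalarTower k[X] (RatFunc k) K := IsScalarTower.of_algebraMap_eq (fun _ => rfl)
  have : IsScalarTower k k[X] K := IsScalarTower.of_algebraMap_eq (fun c => by
    rw [IsScalarTower.algebraMap_apply k[X] (RatFunc k) K,
      ← IsScalarTower.algebraMap_apply k k[X] (RatFunc k),
      ← IsScalarTower.algebraMap_apply k (RatFunc k) K])
  have : FaithfulSMul k[X] K := (faithfulSMul_iff_algebraMap_injective _ _).2 (by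
    rw [IsScalarTower.algebraMap_eq k[X] (RatFunc k) K]
    exact (algebraMap (RatFunc k) K).injective.comp (IsFractionRing.injective k[X] (RatFunc k)))
  have : Algebra.IsAlgebraic k[X] K :=
    (IsFractionRing.comap_isAlgebraic_iff (A := k[X]) (K := RatFunc k) (C := K)).2 inferInstance
  have h := lift_trdeg_add_eq k k[X] K
  rw [trdeg_eq_zero (R := k[X]) (A := K), Polynomial.trdeg_of_isDomain] at h
  simpa using h.symm

theorem ff_transc {k K : Type*} [Field k] [IsAlgClosed k] [Field K] [Algebra k K] {t : K}
    (ht : t ∉ Set.range (algebraMap k K)) : Transcendental k t := by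
  intro h
  apply ht
  have := IntermediateField.adjoin.finiteDimensional h.isIntegral
  obtain ⟨c, hc⟩ := (IsAlgClosed.algebraMap_bijective_of_isIntegral (k := k)
    (K := IntermediateField.adjoin k {t})).2 ⟨t, IntermediateField.mem_adjoin_simple_self k t⟩
  exact ⟨c, congrArg Subtype.val hc⟩

theorem ff_finite {k K : Type*} [Field k] [IsAlgClosed k] [Field K]
    [Algebra (RatFunc k) K] [FiniteDimensional (RatFunc k) K]
    [Algebra k K] [IsScalarTower k (RatFunc k) K] {t : K}
    (ht : t ∉ Set.range (algebraMap k K)) :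
    FiniteDimensional (IntermediateField.adjoin k {t}) K := by
  have htr := ff_transc ht
  have hb : IsTranscendenceBasis k (fun _ : Unit => t) := by
    apply AlgebraicIndependent.isTranscendenceBasis_of_lift_trdeg_le_of_finite
    · exact algebraicIndependent_unique_type_iff.2 htr
    · simp [ff_trdeg k K]
  have h1 := hb.isAlgebraic_field
  rw [Set.range_const] at h1
  have : Algebra.EssFiniteType k[X] (RatFunc k) :=
    Algebra.EssFiniteType.of_isLocalization _ (nonZeroDivisors k[X])
  have : Algebra.EssFiniteType k (RatFunc k) := Algebra.EssFiniteType.comp k k[X] (RatFunc k)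
  have : Algebra.EssFiniteType k K := Algebra.EssFiniteType.comp k (RatFunc k) K
  have : Algebra.EssFiniteType (IntermediateField.adjoin k {t}) K :=
    Algebra.EssFiniteType.of_comp k _ K
  apply Algebra.finite_of_essFiniteType_of_isAlgebraic


namespace FFVal

variable {k K : Type*} [Field k] [Field K] [Algebra k K] (w : FFVal k K)

theorem ext' {w w' : FFVal k K} (h : ∀ f, f ≠ 0 → w.v f = w'.v f) : w = w' := by
  have : w.v = w'.v := by
    funext f
    by_cases hf : f = 0
    · rw [hf, w.v_zero, w'.v_zero]
    · exact h f hf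
  cases w; cases w'; simpa using this

theorem v_one : w.v 1 = 0 := by
  have := w.map_mul 1 1 one_ne_zero one_ne_zero
  rw [mul_one] at this; lia

theorem v_inv (f : K) : w.v f⁻¹ = - w.v f := by
  by_cases hf : f = 0
  · simp [hf, w.v_zero]
  have := w.map_mul f f⁻¹ hf (inv_ne_zero hf)
  rw [mul_inv_cancel₀ hf, v_one] at this; lia

theorem v_div (f g : K) (hf : f ≠ 0) (hg : g ≠ 0) : w.v (f / g) = w.v f - w.v g := by
  rw [div_eq_mul_inv, w.map_mul _ _ hf (inv_ne_zero hg), v_inv]; ring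

theorem v_pow (f : K) (hf : f ≠ 0) (n : ℕ) : w.v (f ^ n) = n * w.v f := by
  induction n with
  | zero => simp [v_one]
  | succ n ih => rw [pow_succ, w.map_mul _ _ (pow_ne_zero _ hf) hf, ih]; push_cast; ring

theorem v_zpow (f : K) (hf : f ≠ 0) (n : ℤ) : w.v (f ^ n) = n * w.v f := by
  cases n with
  | ofNat n => simpa using w.v_pow f hf n
  | negSucc n => rw [zpow_negSucc, v_inv, v_pow _ _ hf, Int.negSucc_eq]; push_cast; ring

theorem v_neg (f : K) : w.v (-f) = w.v f := by
  by_cases hf : f = 0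
  · simp [hf]
  have h1 : w.v (-1) = 0 := by
    have := w.triv (-1) (by simp)
    simpa using this
  rw [neg_eq_neg_one_mul, w.map_mul _ _ (by simp) hf, h1, zero_add]

/-- `w(f) ≥ n` with the convention `w(0) = ∞`. -/
def Ge (n : ℤ) (f : K) : Prop := f ≠ 0 → n ≤ w.v f

variable {w}

theorem Ge.zero (n : ℤ) : w.Ge n 0 := fun h => absurd rfl h

theorem Ge.mono {n m : ℤ} {f : K} (h : w.Ge n f) (hm : m ≤ n) : w.Ge m f :=
  fun hf => hm.trans (h hf)

theorem Ge.add {n : ℤ} {f g : K} (hf : w.Ge n f) (hg : w.Ge n g) : w.Ge n (f + g) := by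
  intro h
  by_cases h1 : f = 0
  · subst h1; rw [zero_add] at h ⊢; exact hg h
  by_cases h2 : g = 0
  · subst h2; rw [add_zero] at h ⊢; exact hf h
  exact (le_min (hf h1) (hg h2)).trans (w.add_min f g h1 h2 h)

theorem Ge.mul {n m : ℤ} {f g : K} (hf : w.Ge n f) (hg : w.Ge m g) : w.Ge (n + m) (f * g) := by
  intro h
  have h1 := left_ne_zero_of_mul h
  have h2 := right_ne_zero_of_mul h
  rw [w.map_mul _ _ h1 h2]
  exact add_le_add (hf h1) (hg h2)

theorem Ge.neg {n : ℤ} {f : K} (hf : w.Ge n f) : w.Ge n (-f) := by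
  intro h
  rw [v_neg]; exact hf (by simpa using h)

theorem Ge.sub {n : ℤ} {f g : K} (hf : w.Ge n f) (hg : w.Ge n g) : w.Ge n (f - g) := by
  rw [sub_eq_add_neg]; exact hf.add hg.neg

theorem Ge.sum {ι : Type*} {n : ℤ} {s : Finset ι} {f : ι → K} (h : ∀ i ∈ s, w.Ge n (f i)) :
    w.Ge n (∑ i ∈ s, f i) := by
  classical
  induction s using Finset.induction_on with
  | empty => simpa using Ge.zero n
  | insert a s ha ih =>
    rw [Finset.sum_insert ha]
    exact (h a (by simp)).add (ih (fun i hi => h i (by simp [hi])))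

theorem Ge.self (f : K) : w.Ge (w.v f) f := fun _ => le_rfl

theorem v_const (c : k) : w.v (algebraMap k K c) = 0 := by
  by_cases hc : c = 0
  · simp [hc, w.v_zero]
  · exact w.triv c hc

theorem Ge.const (c : k) : w.Ge 0 (algebraMap k K c) := fun _ => v_const c |>.ge

theorem Ge.smul {n : ℤ} {f : K} (hf : w.Ge n f) (c : k) : w.Ge n (c • f) := by
  rw [Algebra.smul_def]; simpa using (Ge.const c).mul hf

theorem Ge.pow {n : ℤ} {f : K} (hf : w.Ge n f) (m : ℕ) : w.Ge (m * n) (f ^ m) := by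
  intro h
  by_cases hm : m = 0
  · subst hm; simp [v_one]
  have h1 : f ≠ 0 := by rintro rfl; simp [hm] at h
  rw [v_pow _ _ h1]; exact mul_le_mul_of_nonneg_left (hf h1) (by positivity)

theorem ge_mul_iff {n : ℤ} {f g : K} (hf : f ≠ 0) : w.Ge n (f * g) ↔ w.Ge (n - w.v f) g := by
  constructor
  · intro h hg
    have := h (mul_ne_zero hf hg)
    rw [w.map_mul _ _ hf hg] at this; lia
  · intro h hg
    have hg' := right_ne_zero_of_mul hg
    rw [w.map_mul _ _ hf hg']; have := h hg'; lia

theorem Ge.aeval {f : K} (hf : w.Ge 0 f) (p : k[X]) : w.Ge 0 (aeval f p) := by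
  rw [aeval_eq_sum_range]
  apply Ge.sum
  intro i _
  exact Ge.smul (by simpa using hf.pow i) _

/-- integral elements over a subring of integers are integers -/
theorem Ge.of_isIntegral {A : Type*} [CommRing A] [Algebra A K]
    (hA : ∀ a : A, w.Ge 0 (algebraMap A K a)) {f : K} (hf : IsIntegral A f) : w.Ge 0 f := by
  intro h0
  by_contra hlt
  push Not at hlt
  obtain ⟨p, hp, hpf⟩ := hf
  rw [← Polynomial.aeval_def, aeval_eq_sum_range, Finset.sum_range_succ] at hpf
  rw [hp.coeff_natDegree, one_smul] at hpf
  have hd : p.natDegree ≠ 0 := by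
    intro h
    rw [h] at hpf; simp at hpf
  have h1 : w.Ge ((p.natDegree - 1) * w.v f)
      (∑ i ∈ Finset.range p.natDegree, p.coeff i • f ^ i) := by
    apply Ge.sum
    intro i hi
    rw [Finset.mem_range] at hi
    rw [Algebra.smul_def]
    refine ((hA _).mul ((Ge.self f).pow i)).mono ?_
    rw [zero_add]
    apply mul_le_mul_of_nonpos_right _ hlt.le
    lia
  have h2 : f ^ p.natDegree = - ∑ i ∈ Finset.range p.natDegree, p.coeff i • f ^ i := by
    linear_combination hpf
  have h3 := h1.neg
  rw [← h2] at h3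
  have h4 := h3 (pow_ne_zero _ h0)
  rw [v_pow _ _ h0] at h4
  nlinarith

end FFVal


section Dedekind

open IsDedekindDomain

/-- The place attached to a prime of a Dedekind domain containing `k`. -/
noncomputable def FFVal.ofPrime {k K O : Type*} [Field k] [Field K] [Algebra k K] [CommRing O]
    [IsDedekindDomain O] [Algebra O K] [IsFractionRing O K] [Algebra k O] [IsScalarTower k O K]
    (P : HeightOneSpectrum O) : FFVal k K where
  v f := - WithZero.log (P.valuation K f)
  v_zero := by simp
  map_mul x y hx hy := by
    rw [_root_.map_mul, WithZero.log_mul (by simpa) (by simpa)]; ring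
  add_min x y hx hy hxy := by
    have h := (P.valuation K).map_add x y
    rcases le_max_iff.1 h with h | h
    · rw [← WithZero.log_le_log (by simpa) (by simpa)] at h
      exact (min_le_left _ _).trans (neg_le_neg h)
    · rw [← WithZero.log_le_log (by simpa) (by simpa)] at h
      exact (min_le_right _ _).trans (neg_le_neg h)
  surj n := by
    obtain ⟨x, hx⟩ := P.valuation_surjective K (WithZero.exp (-n))
    refine ⟨x, ?_, by rw [hx]; simp⟩
    rintro rfl
    rw [map_zero] at hx
    exact WithZero.exp_ne_zero hx.symm
  triv c hc := by
    have hu : IsUnit (algebraMap k O c) := (isUnit_iff_ne_zero.2 hc).map _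
    have h1 : P.valuation K (algebraMap O K (algebraMap k O c)) = 1 := by
      rw [P.valuation_eq_one_iff_notMem]
      intro h
      exact P.isPrime.ne_top (Ideal.eq_top_of_isUnit_mem _ h hu)
    rw [← IsScalarTower.algebraMap_apply] at h1
    rw [h1]; simp

variable {k K O : Type*} [Field k] [Field K] [Algebra k K] [CommRing O]
    [IsDedekindDomain O] [Algebra O K] [IsFractionRing O K] [Algebra k O] [IsScalarTower k O K]

theorem FFVal.ofPrime_ge_zero (P : HeightOneSpectrum O) (f : K) :
    (FFVal.ofPrime (k := k) P).Ge 0 f ↔ P.valuation K f ≤ 1 := by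
  by_cases hf : f = 0
  · subst hf; simp [FFVal.Ge]
  have h0 : P.valuation K f ≠ 0 := by simpa
  simp only [FFVal.Ge, FFVal.ofPrime, ne_eq, hf, not_false_eq_true, forall_const]
  rw [← WithZero.log_le_log h0 one_ne_zero, WithZero.log_one]
  lia

theorem FFVal.ofPrime_ge_one (P : HeightOneSpectrum O) (f : K) :
    (FFVal.ofPrime (k := k) P).Ge 1 f ↔ P.valuation K f < 1 := by
  by_cases hf : f = 0
  · subst hf; simp [FFVal.Ge]
  have h0 : P.valuation K f ≠ 0 := by simpa
  simp only [FFVal.Ge, FFVal.ofPrime, ne_eq, hf, not_false_eq_true, forall_const]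
  rw [← WithZero.log_lt_log h0 one_ne_zero, WithZero.log_one]
  lia

theorem FFVal.ofPrime_injective :
    Function.Injective (FFVal.ofPrime (k := k) (K := K) (O := O)) := by
  intro P Q h
  apply HeightOneSpectrum.ext
  ext a
  rw [← P.valuation_lt_one_iff_mem (K := K), ← Q.valuation_lt_one_iff_mem (K := K),
    ← FFVal.ofPrime_ge_one (k := k), ← FFVal.ofPrime_ge_one (k := k), h]

theorem FFVal.exists_ofPrime (w : FFVal k K) (hw : ∀ a : O, w.Ge 0 (algebraMap O K a)) :
    ∃ P : HeightOneSpectrum O, FFVal.ofPrime P = w := by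
  let I : Ideal O :=
    { carrier := {a | w.Ge 1 (algebraMap O K a)}
      add_mem' := fun {a b} ha hb => by
        simp only [Set.mem_ofPred_eq, map_add] at *; exact ha.add hb
      zero_mem' := by simpa using FFVal.Ge.zero 1
      smul_mem' := fun c a ha => by
        simp only [Set.mem_ofPred_eq, smul_eq_mul, _root_.map_mul] at *
        simpa using (hw c).mul ha }
  have hI : ∀ a, a ∈ I ↔ w.Ge 1 (algebraMap O K a) := fun a => Iff.rfl
  have hinj := IsFractionRing.injective O K
  have hunit : ∀ a, a ∉ I → a ≠ 0 ∧ w.v (algebraMap O K a) = 0 := by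
    intro a ha
    rw [hI, FFVal.Ge] at ha
    push Not at ha
    have := hw a ha.1
    refine ⟨fun h => ha.1 (by simp [h]), by lia⟩
  have hprime : I.IsPrime := by
    refine ⟨?_, ?_⟩
    · rw [Ideal.ne_top_iff_one, hI]
      intro h
      have := h (by simp)
      rw [map_one, FFVal.v_one] at this; lia
    · intro a b hab
      by_contra hcon
      push Not at hcon
      obtain ⟨ha, ha'⟩ := hunit a hcon.1
      obtain ⟨hb, hb'⟩ := hunit b hcon.2
      rw [hI, _root_.map_mul] at hab
      have hane : algebraMap O K a ≠ 0 := by simpa using ha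
      have hbne : algebraMap O K b ≠ 0 := by simpa using hb
      have := hab (mul_ne_zero hane hbne)
      rw [w.map_mul _ _ hane hbne] at this
      lia
  have hbot : I ≠ ⊥ := by
    intro h
    obtain ⟨f, hf, hfv⟩ := w.surj 1
    obtain ⟨a, b, hb, rfl⟩ := IsFractionRing.div_surjective (A := O) f
    have hb0 : b ≠ 0 := nonZeroDivisors.ne_zero hb
    have ha0 : a ≠ 0 := by rintro rfl; simp at hf
    have h1 := (hunit a (by rw [h]; simpa using ha0)).2
    have h2 := (hunit b (by rw [h]; simpa using hb0)).2
    rw [w.v_div _ _ (by simpa using ha0) (by simpa using hb0)] at hfv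
    lia
  let P : HeightOneSpectrum O := ⟨I, hprime, hbot⟩
  refine ⟨P, ?_⟩
  -- `P`-units are `w`-units
  have key : ∀ f : K, f ≠ 0 → (FFVal.ofPrime (k := k) P).v f = 0 → w.v f = 0 := by
    have half : ∀ f : K, f ≠ 0 → (FFVal.ofPrime (k := k) P).v f = 0 → 0 ≤ w.v f := by
      intro f hf hfv
      have h1 : P.valuation K f ≤ 1 := by
        rw [← FFVal.ofPrime_ge_zero (k := k)]
        intro _; exact hfv.ge
      obtain ⟨n, d, hnd⟩ := P.exists_primeCompl_mul_eq_of_integer f h1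
      obtain ⟨hd, hd'⟩ := hunit d.1 d.2
      have hdne : algebraMap O K d ≠ 0 := by simpa using hd
      have h2 := hw n
      rw [← hnd] at h2
      have h3 := h2 (mul_ne_zero hf hdne)
      rw [w.map_mul _ _ hf hdne] at h3
      lia
    intro f hf hfv
    have h1 := half f hf hfv
    have h2 := half f⁻¹ (inv_ne_zero hf) (by rw [FFVal.v_inv, hfv, neg_zero])
    rw [FFVal.v_inv] at h2
    lia
  obtain ⟨π, hπ, hπv⟩ := (FFVal.ofPrime (k := k) (K := K) P).surj 1
  have hall : ∀ f : K, f ≠ 0 → w.v f = (FFVal.ofPrime (k := k) P).v f * w.v π := by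
    intro f hf
    have h1 := key (f / π ^ ((FFVal.ofPrime (k := k) P).v f)) (div_ne_zero hf (zpow_ne_zero _ hπ))
      (by rw [FFVal.v_div _ _ _ hf (zpow_ne_zero _ hπ), FFVal.v_zpow _ _ hπ, hπv]; ring)
    rw [FFVal.v_div _ _ _ hf (zpow_ne_zero _ hπ), FFVal.v_zpow _ _ hπ] at h1
    lia
  -- positivity
  have hpos : 0 < w.v π := by
    obtain ⟨a, ha, ha0⟩ := Submodule.exists_mem_ne_zero_of_ne_bot hbot
    have hane : algebraMap O K a ≠ 0 := by simpa using ha0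
    have h1 : 1 ≤ w.v (algebraMap O K a) := (hI a).1 ha hane
    have h2 : (FFVal.ofPrime (k := k) P).Ge 0 (algebraMap O K a) := by
      rw [FFVal.ofPrime_ge_zero]; exact P.valuation_le_one a
    have h2 := h2 hane
    rw [hall _ hane] at h1
    by_contra hcon
    push Not at hcon
    nlinarith
  have hone : w.v π = 1 := by
    obtain ⟨f, hf, hfv⟩ := w.surj 1
    rw [hall f hf] at hfv
    exact Int.eq_one_of_mul_eq_one_left hpos.le hfv
  apply FFVal.ext'
  intro f hf
  rw [hall f hf, hone, mul_one]

end Dedekind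


section Cover

open IsDedekindDomain Module

theorem cover_sep {k : Type*} (F : Type*) {K : Type*} [Field k] [IsAlgClosed k] [CharZero k] [Field F]
    [Field K] [Algebra k K] [Algebra k[X] F] [IsFractionRing k[X] F] [Algebra F K]
    [FiniteDimensional F K] [Algebra k[X] K] [IsScalarTower k[X] F K] [IsScalarTower k k[X] K]
    : Algebra.IsSeparable F K := by
  have : CharZero F :=
    charZero_of_injective_algebraMap (IsFractionRing.injective k[X] F)
  infer_instance

theorem cover_dedekind {k : Type*} (F : Type*) {K : Type*} [Field k] [IsAlgClosed k] [CharZero k] [Field F]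
    [Field K] [Algebra k K] [Algebra k[X] F] [IsFractionRing k[X] F] [Algebra F K]
    [FiniteDimensional F K] [Algebra k[X] K] [IsScalarTower k[X] F K] [IsScalarTower k k[X] K]
    : IsDedekindDomain (integralClosure k[X] K) := by
  have := cover_sep (k := k) F (K := K)
  exact integralClosure.isDedekindDomain k[X] F K

theorem cover_frac {k : Type*} (F : Type*) {K : Type*} [Field k] [IsAlgClosed k] [CharZero k] [Field F]
    [Field K] [Algebra k K] [Algebra k[X] F] [IsFractionRing k[X] F] [Algebra F K]
    [FiniteDimensional F K] [Algebra k[X] K] [IsScalarTower k[X] F K] [IsScalarTower k k[X] K]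
    : IsFractionRing (integralClosure k[X] K) K :=
  integralClosure.isFractionRing_of_finite_extension F K

theorem cover_ge {k K : Type*} [Field k] [Field K] [Algebra k K] [Algebra k[X] K] [IsScalarTower k k[X] K]
    {w : FFVal k K} (hw : w.Ge 0 (algebraMap k[X] K X)) (p : k[X]) :
    w.Ge 0 (algebraMap k[X] K p) := by
  have := hw.aeval p
  rwa [aeval_algebraMap_apply, aeval_X_left_apply] at this

theorem cover_integral {k : Type*} (F : Type*) {K : Type*} [Field k] [IsAlgClosed k] [CharZero k] [Field F]
    [Field K] [Algebra k K] [Algebra k[X] F] [IsFractionRing k[X] F] [Algebra F K]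
    [FiniteDimensional F K] [Algebra k[X] K] [IsScalarTower k[X] F K] [IsScalarTower k k[X] K]
    {f : K} (hf : ∀ w : FFVal k K, w.Ge 0 (algebraMap k[X] K X) → w.Ge 0 f) :
    IsIntegral k[X] f := by
  have := cover_dedekind (k := k) F (K := K)
  have := cover_frac (k := k) F (K := K)
  obtain ⟨a, ha⟩ := HeightOneSpectrum.mem_integers_of_valuation_le_one
    (R := integralClosure k[X] K) K f (fun P => by
      rw [← FFVal.ofPrime_ge_zero (k := k)]
      apply hf
      rw [FFVal.ofPrime_ge_zero]
      rw [IsScalarTower.algebraMap_apply k[X] (integralClosure k[X] K) K]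
      exact P.valuation_le_one _)
  rw [← ha]
  exact a.2

theorem cover_prime {k : Type*} (F : Type*) {K : Type*} [Field k] [IsAlgClosed k] [CharZero k] [Field F]
    [Field K] [Algebra k K] [Algebra k[X] F] [IsFractionRing k[X] F] [Algebra F K]
    [FiniteDimensional F K] [Algebra k[X] K] [IsScalarTower k[X] F K] [IsScalarTower k k[X] K]
    {w : FFVal k K} (hw : w.Ge 0 (algebraMap k[X] K X)) :
    ∃ (_ : IsDedekindDomain (integralClosure k[X] K)) (_ : IsFractionRing (integralClosure k[X] K) K)
    (P : HeightOneSpectrum (integralClosure k[X] K)), FFVal.ofPrime P = w := by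
  have h1 := cover_dedekind (k := k) F (K := K)
  have h2 := cover_frac (k := k) F (K := K)
  refine ⟨h1, h2, ?_⟩
  apply FFVal.exists_ofPrime
  intro a
  exact FFVal.Ge.of_isIntegral (A := k[X]) (cover_ge hw) a.2

theorem cover_residue {k : Type*} (F : Type*) {K : Type*} [Field k] [IsAlgClosed k] [CharZero k] [Field F]
    [Field K] [Algebra k K] [Algebra k[X] F] [IsFractionRing k[X] F] [Algebra F K]
    [FiniteDimensional F K] [Algebra k[X] K] [IsScalarTower k[X] F K] [IsScalarTower k k[X] K]
    {w : FFVal k K} (hw : w.Ge 0 (algebraMap k[X] K X)) :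
    ∃ c : k, w.Ge 1 (algebraMap k[X] K X - algebraMap k K c) := by
  obtain ⟨_, _, P, rfl⟩ := cover_prime F hw
  have h1 : P.asIdeal.comap (algebraMap k[X] (integralClosure k[X] K)) ≠ ⊥ := by
    intro h
    exact P.ne_bot (Ideal.eq_bot_of_comap_eq_bot h)
  have := P.isPrime
  obtain ⟨q, hq, hq0⟩ := Submodule.exists_mem_ne_zero_of_ne_bot h1
  rw [(IsAlgClosed.splits q).eq_prod_roots] at hq
  have h2 := (Ideal.IsPrime.mem_or_mem (Ideal.comap_isPrime _ _) hq).resolve_left (by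
    intro h
    refine (Ideal.comap_isPrime (algebraMap k[X] (integralClosure k[X] K)) P.asIdeal).ne_top
      (Ideal.eq_top_of_isUnit_mem _ h ?_)
    simpa using hq0)
  obtain ⟨r, hr, hr'⟩ := (Ideal.IsPrime.multiset_prod_mem_iff_exists_mem inferInstance _).1 h2
  obtain ⟨c, _, rfl⟩ := Multiset.mem_map.1 hr
  refine ⟨c, ?_⟩
  rw [FFVal.ofPrime_ge_one]
  rw [Ideal.mem_comap, ← P.valuation_lt_one_iff_mem (K := K)] at hr'
  change P.valuation K (algebraMap k[X] K (X - C c)) < 1 at hr'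
  rw [map_sub] at hr'
  rw [IsScalarTower.algebraMap_apply k k[X] K]
  exact hr'

theorem cover_trace {k : Type*} (F : Type*) {K : Type*} [Field k] [IsAlgClosed k] [CharZero k] [Field F]
    [Field K] [Algebra k K] [Algebra k[X] F] [IsFractionRing k[X] F] [Algebra F K]
    [FiniteDimensional F K] [Algebra k[X] K] [IsScalarTower k[X] F K] [IsScalarTower k k[X] K]
    {f : K} (hf : ∀ w : FFVal k K, w.Ge 0 (algebraMap k[X] K X) → w.Ge 0 f) :
    ∃ p : k[X], Algebra.trace F K f = algebraMap k[X] F p ∧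
      ((∀ w : FFVal k K, w.Ge 1 (algebraMap k[X] K X) → w.Ge 1 f) → X ∣ p) := by
  have hd := cover_dedekind (k := k) F (K := K)
  have hfr := cover_frac (k := k) F (K := K)
  have hsep := cover_sep (k := k) F (K := K)
  let O := integralClosure k[X] K
  have hfin : Module.Finite k[X] O := IsIntegralClosure.finite k[X] F K O
  have htf : Module.IsTorsionFree k[X] K := by
    have hinj : Function.Injective (algebraMap k[X] K) := by
      rw [IsScalarTower.algebraMap_eq k[X] F K]
      exact (algebraMap F K).injective.comp (IsFractionRing.injective k[X] F)
    have := (faithfulSMul_iff_algebraMap_injective k[X] K).2 hinj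
    infer_instance
  have hfree : Module.Free k[X] O := IsIntegralClosure.module_free k[X] F K O
  let a : O := ⟨f, cover_integral F hf⟩
  refine ⟨Algebra.trace k[X] O a, ?_, ?_⟩
  · rw [← Algebra.intTrace_eq_trace k[X] O, Algebra.algebraMap_intTrace (A := k[X]) (K := F) (L := K) (B := O)]
    rfl
  · intro hf1
    have hrad : a ∈ (Ideal.span {algebraMap k[X] O X}).radical := by
      rw [Ideal.radical_eq_sInf, Ideal.mem_sInf]
      rintro J ⟨hJ, hJp⟩
      have hXJ : algebraMap k[X] O X ∈ J := hJ (Ideal.mem_span_singleton_self _)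
      have hJ0 : J ≠ ⊥ := by
        rintro rfl
        have h1 : algebraMap k[X] O X = 0 := by simpa using hXJ
        rw [FaithfulSMul.algebraMap_eq_zero_iff] at h1
        exact X_ne_zero h1
      let P : HeightOneSpectrum O := ⟨J, hJp, hJ0⟩
      change a ∈ P.asIdeal
      rw [← P.valuation_lt_one_iff_mem (K := K), ← FFVal.ofPrime_ge_one (k := k)]
      apply hf1
      rw [FFVal.ofPrime_ge_one, IsScalarTower.algebraMap_apply k[X] O K,
        P.valuation_lt_one_iff_mem]
      exact hXJ
    obtain ⟨m, hm⟩ := hrad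
    obtain ⟨g, hg⟩ := Ideal.mem_span_singleton'.1 hm
    let b := Module.Free.chooseBasis k[X] O
    let M := Algebra.leftMulMatrix b a
    have hM : M ^ m = (X : k[X]) • Algebra.leftMulMatrix b g := by
      rw [← map_pow, ← hg, ← map_smul, Algebra.smul_def, mul_comm]
    have hnil : IsNilpotent (M.map (constantCoeff (R := k))) := by
      refine ⟨m, ?_⟩
      have : (M ^ m).map (constantCoeff (R := k)) = (M.map (constantCoeff (R := k))) ^ m :=
        map_pow (constantCoeff (R := k)).mapMatrix M m
      rw [← this, hM]
      ext i j
      simp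
    have h1 := (Matrix.isNilpotent_trace_of_isNilpotent hnil).eq_zero
    rw [X_dvd_iff, Algebra.trace_eq_matrix_trace b]
    rw [← AddMonoidHom.map_trace] at h1
    simpa using h1

theorem cover_count {k : Type*} (F : Type*) {K : Type*} [Field k] [IsAlgClosed k] [CharZero k] [Field F]
    [Field K] [Algebra k K] [Algebra k[X] F] [IsFractionRing k[X] F] [Algebra F K]
    [FiniteDimensional F K] [Algebra k[X] K] [IsScalarTower k[X] F K] [IsScalarTower k k[X] K]
    : ∃ s : Finset (FFVal k K),
    (∀ w, w ∈ s ↔ 0 < w.v (algebraMap k[X] K X)) ∧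
    ∑ w ∈ s, w.v (algebraMap k[X] K X) = finrank F K := by
  classical
  have hd := cover_dedekind (k := k) F (K := K)
  have hfr := cover_frac (k := k) F (K := K)
  have hsep := cover_sep (k := k) F (K := K)
  let O := integralClosure k[X] K
  have hfin : Module.Finite k[X] O := IsIntegralClosure.finite k[X] F K O
  have htf : Module.IsTorsionFree k[X] K := by
    have hinj : Function.Injective (algebraMap k[X] K) := by
      rw [IsScalarTower.algebraMap_eq k[X] F K]
      exact (algebraMap F K).injective.comp (IsFractionRing.injective k[X] F)
    have := (faithfulSMul_iff_algebraMap_injective k[X] K).2 hinj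
    infer_instance
  have htf : Module.IsTorsionFree k[X] O := inferInstance
  have hff : FaithfulSMul k[X] O := inferInstance
  let p : Ideal k[X] := Ideal.span {X - C 0}
  have hp0 : p ≠ ⊥ := by simp [p]
  have hpX : p = Ideal.span {X} := by simp [p]
  let e := Polynomial.quotientSpanXSubCAlgEquiv (0 : k)
  have hpm : p.IsMaximal := by
    apply Ideal.Quotient.maximal_of_isField
    exact e.toMulEquiv.isField (Field.toIsField k)
  let P0 : HeightOneSpectrum k[X] := ⟨p, hpm.isPrime, hp0⟩
  have hs := Ideal.sum_ramification_inertia O F K hp0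
  have hmem : ∀ P : Ideal O, P ∈ IsDedekindDomain.primesOverFinset p O ↔ P ∈ p.primesOver O := fun P => by
    rw [IsDedekindDomain.mem_primesOverFinset_iff hp0]
  have hne : ∀ P : Ideal O, P ∈ IsDedekindDomain.primesOverFinset p O → P ≠ ⊥ := by
    intro P hP
    have := ((hmem P).1 hP).2
    exact Ideal.ne_bot_of_liesOver_of_ne_bot hp0 P
  let φ : {P // P ∈ IsDedekindDomain.primesOverFinset p O} → HeightOneSpectrum O := fun P =>
    ⟨P.1, ((hmem P.1).1 P.2).1, hne P.1 P.2⟩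
  have hXv : ∀ P, (FFVal.ofPrime (k := k) (K := K) (φ P)).v (algebraMap k[X] K X) =
      Ideal.ramificationIdx' p P.1 * Ideal.inertiaDeg' p P.1 := by
    intro P
    have hlo : P.1.LiesOver p := ((hmem P.1).1 P.2).2
    have : (φ P).asIdeal.LiesOver P0.asIdeal := hlo
    have hin : Ideal.inertiaDeg' p P.1 = 1 := by
      have hP1 : P.1.IsPrime := ((hmem P.1).1 P.2).1
      have hPm : P.1.IsMaximal := hP1.isMaximal (hne P.1 P.2)
      rw [Ideal.inertiaDeg'_algebraMap]
      let := Ideal.Quotient.field p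
      let := Ideal.Quotient.field P.1
      have : IsAlgClosed (k[X] ⧸ p) := IsAlgClosed.of_ringEquiv k _ e.symm.toRingEquiv
      have hb := IsAlgClosed.algebraMap_bijective_of_isIntegral (k := k[X] ⧸ p) (K := O ⧸ P.1)
      exact Algebra.finrank_eq_one_iff_bijective_algebraMap.2 hb
    have h1 := HeightOneSpectrum.intValuation_liesOver P0 (φ P) X
    rw [P0.intValuation_singleton X_ne_zero hpX] at h1
    rw [hin, Nat.cast_one, mul_one]
    change - WithZero.log _ = _
    rw [IsScalarTower.algebraMap_apply k[X] O K, HeightOneSpectrum.valuation_of_algebraMap, ← h1]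
    simp [P0, φ]
  have hinj : Function.Injective (fun P => FFVal.ofPrime (k := k) (K := K) (φ P)) := by
    intro P Q h
    have := FFVal.ofPrime_injective h
    exact Subtype.ext (congrArg HeightOneSpectrum.asIdeal this)
  refine ⟨(IsDedekindDomain.primesOverFinset p O).attach.image
    (fun P => FFVal.ofPrime (k := k) (K := K) (φ P)), ?_, ?_⟩
  · intro w
    simp only [Finset.mem_image, Finset.mem_attach, true_and]
    constructor
    · rintro ⟨P, rfl⟩
      have hlo : P.1.LiesOver p := ((hmem P.1).1 P.2).2
      have hXP : algebraMap k[X] O X ∈ (φ P).asIdeal := by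
        have : (X : k[X]) ∈ p := by rw [hpX]; exact Ideal.mem_span_singleton_self _
        rw [hlo.over] at this
        exact this
      rw [← HeightOneSpectrum.valuation_lt_one_iff_mem (K := K),
        ← FFVal.ofPrime_ge_one (k := k)] at hXP
      have h0 : algebraMap k[X] K X ≠ 0 := by
        rw [IsScalarTower.algebraMap_apply k[X] F K, map_ne_zero_iff _ (algebraMap F K).injective,
          map_ne_zero_iff _ (IsFractionRing.injective k[X] F)]
        exact X_ne_zero
      have h1 : 1 ≤ (FFVal.ofPrime (k := k) (K := K) (φ P)).v (algebraMap k[X] K X) := hXP h0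
      lia
    · intro hw
      obtain ⟨_, _, P, rfl⟩ := cover_prime F (w := w) (fun _ => hw.le)
      have hP : P.asIdeal ∈ IsDedekindDomain.primesOverFinset p O := by
        rw [hmem]
        refine ⟨P.isPrime, ⟨?_⟩⟩
        have := P.isPrime
        refine (hpm.eq_of_le (Ideal.comap_isPrime _ _).ne_top ?_)
        rw [hpX, Ideal.span_singleton_le_iff_mem, Ideal.mem_comap,
          ← P.valuation_lt_one_iff_mem (K := K), ← FFVal.ofPrime_ge_one (k := k)]
        intro _; exact hw
      exact ⟨⟨P.asIdeal, hP⟩, rfl⟩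
  · rw [Finset.sum_image hinj.injOn]
    simp only [hXv]
    rw [Finset.sum_attach (IsDedekindDomain.primesOverFinset p O)
      (fun P => ((Ideal.ramificationIdx' p P : ℤ) * Ideal.inertiaDeg' p P)), ← hs]
    push_cast
    rfl

end Cover


section Adj

theorem adj_setup {k K : Type*} [Field k] [IsAlgClosed k] [Field K] [Algebra k K]
    (F : IntermediateField k K) (t : K) (hF : F = IntermediateField.adjoin k {t})
    (ht : t ∉ Set.range (algebraMap k K)) :
    ∃ (_ : Algebra k[X] F) (_ : IsFractionRing k[X] F) (_ : Algebra k[X] K)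
      (_ : IsScalarTower k[X] F K) (_ : IsScalarTower k k[X] K),
      (∀ p : k[X], algebraMap k[X] K p = aeval t p) := by
  have htF : t ∈ F := by rw [hF]; exact IntermediateField.mem_adjoin_simple_self k t
  have htr := ff_transc ht
  let i1 : Algebra k[X] F := (aeval (R := k) (⟨t, htF⟩ : F)).toRingHom.toAlgebra
  let i2 : Algebra k[X] K := (aeval (R := k) t).toRingHom.toAlgebra
  have hF1 : ∀ p : k[X], algebraMap k[X] F p = aeval (⟨t, htF⟩ : F) p := fun _ => rfl
  have hK1 : ∀ p : k[X], algebraMap k[X] K p = aeval t p := fun _ => rfl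
  have hc : ∀ p : k[X], algebraMap F K (algebraMap k[X] F p) = aeval t p := fun p => by
    rw [hF1, ← aeval_algebraMap_apply]; rfl
  have hinj : Function.Injective (algebraMap k[X] F) := by
    intro p q h
    have := congrArg (algebraMap F K) h
    rw [hc, hc] at this
    exact transcendental_iff_injective.1 htr this
  have i3 : IsScalarTower k[X] F K := IsScalarTower.of_algebraMap_eq (fun p => by rw [hc, hK1])
  have i4 : IsScalarTower k k[X] K := IsScalarTower.of_algebraMap_eq (fun c => by
    rw [hK1, Polynomial.algebraMap_eq, aeval_C])
  have := (faithfulSMul_iff_algebraMap_injective k[X] F).2 hinj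
  refine ⟨i1, ?_, i2, i3, i4, hK1⟩
  apply IsFractionRing.of_field
  rintro ⟨z, hz⟩
  have hz' := hz
  rw [hF, IntermediateField.mem_adjoin_simple_iff] at hz'
  obtain ⟨p, q, h⟩ := hz'
  refine ⟨p, q, (algebraMap F K).injective ?_⟩
  rw [map_div₀, hc, hc, ← h]
  rfl

variable {k K : Type*} [Field k] [IsAlgClosed k] [CharZero k] [Field K] [Algebra k K]
    {F : IntermediateField k K} {t : K} 

theorem adj_residue [FiniteDimensional F K] (hF : F = IntermediateField.adjoin k {t})
    (ht : t ∉ Set.range (algebraMap k K)) {w : FFVal k K} (hw : w.Ge 0 t) :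
    ∃ c : k, w.Ge 1 (t - algebraMap k K c) := by
  obtain ⟨i1, i2, i3, i4, i5, h⟩ := adj_setup F t hF ht
  have hX := h X
  rw [aeval_X] at hX
  have := cover_residue F (w := w)
  rw [hX] at this
  exact this hw

theorem adj_trace [FiniteDimensional F K] (hF : F = IntermediateField.adjoin k {t})
    (ht : t ∉ Set.range (algebraMap k K)) {f : K}
    (hf : ∀ w : FFVal k K, w.Ge 0 t → w.Ge 0 f) :
    ∃ p : k[X], algebraMap F K (Algebra.trace F K f) = aeval t p ∧
      ((∀ w : FFVal k K, w.Ge 1 t → w.Ge 1 f) → X ∣ p) := by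
  obtain ⟨i1, i2, i3, i4, i5, h⟩ := adj_setup F t hF ht
  have hX := h X
  rw [aeval_X] at hX
  have := cover_trace (k := k) F (f := f)
  rw [hX] at this
  obtain ⟨p, hp, hp'⟩ := this hf
  refine ⟨p, ?_, hp'⟩
  rw [hp, ← IsScalarTower.algebraMap_apply, h]

theorem adj_count [FiniteDimensional F K] (hF : F = IntermediateField.adjoin k {t})
    (ht : t ∉ Set.range (algebraMap k K)) : ∃ s : Finset (FFVal k K),
    (∀ w, w ∈ s ↔ 0 < w.v t) ∧ ∑ w ∈ s, w.v t = Module.finrank F K := by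
  obtain ⟨i1, i2, i3, i4, i5, h⟩ := adj_setup F t hF ht
  have hX := h X
  rw [aeval_X] at hX
  have := cover_count (k := k) F (K := K)
  rw [hX] at this
  exact this

end Adj


set_option linter.unusedSectionVars false
section Deg

/-- All simple transcendental subextensions have finite index. -/
def FFin (k K : Type*) [Field k] [Field K] [Algebra k K] : Prop :=
  ∀ t : K, t ∉ Set.range (algebraMap k K) → FiniteDimensional (IntermediateField.adjoin k {t}) K

theorem adj_inv {k K : Type*} [Field k] [Field K] [Algebra k K] (t : K) :
    IntermediateField.adjoin k {t} = IntermediateField.adjoin k {t⁻¹} := by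
  apply le_antisymm
  · rw [IntermediateField.adjoin_simple_le_iff]
    have := inv_mem (IntermediateField.mem_adjoin_simple_self k t⁻¹)
    rwa [inv_inv] at this
  · rw [IntermediateField.adjoin_simple_le_iff]
    exact inv_mem (IntermediateField.mem_adjoin_simple_self k t)

theorem inv_notMem_range {k K : Type*} [Field k] [Field K] [Algebra k K] {t : K}
    (ht : t ∉ Set.range (algebraMap k K)) : t⁻¹ ∉ Set.range (algebraMap k K) := by
  rintro ⟨c, hc⟩
  exact ht ⟨c⁻¹, by rw [map_inv₀, hc, inv_inv]⟩

variable {k K : Type*} [Field k] [IsAlgClosed k] [CharZero k] [Field K] [Algebra k K]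

theorem ff_count (H : FFin k K) {t : K} (ht : t ∉ Set.range (algebraMap k K)) :
    ∃ s : Finset (FFVal k K), (∀ w, w ∈ s ↔ 0 < w.v t) ∧
      ∑ w ∈ s, w.v t = Module.finrank (IntermediateField.adjoin k {t}) K := by
  have := H t ht
  exact adj_count rfl ht

theorem ff_count_inv (H : FFin k K) {t : K} (ht : t ∉ Set.range (algebraMap k K)) :
    ∃ s : Finset (FFVal k K), (∀ w, w ∈ s ↔ 0 < w.v t⁻¹) ∧
      ∑ w ∈ s, w.v t⁻¹ = Module.finrank (IntermediateField.adjoin k {t}) K := by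
  have := H t ht
  exact adj_count (adj_inv t) (inv_notMem_range ht)

theorem ff_support (H : FFin k K) (t : K) : {w : FFVal k K | w.v t ≠ 0}.Finite := by
  by_cases ht : t ∈ Set.range (algebraMap k K)
  · obtain ⟨c, rfl⟩ := ht
    convert! Set.finite_empty
    ext w
    simp [FFVal.v_const]
  · obtain ⟨s, hs, -⟩ := ff_count H ht
    obtain ⟨s', hs', -⟩ := ff_count_inv H ht
    classical
    refine (s ∪ s').finite_toSet.subset ?_
    intro w hw
    rw [Finset.coe_union, Set.mem_union, Finset.mem_coe, Finset.mem_coe, hs, hs', FFVal.v_inv]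
    have : w.v t ≠ 0 := hw
    lia

/-- the divisor of a function -/
noncomputable def dv (H : FFin k K) (t : K) : FFVal k K →₀ ℤ :=
  Finsupp.ofSupportFinite (fun w => w.v t) (ff_support H t)

/-- the divisor of zeros of a function -/
noncomputable def zd (H : FFin k K) (t : K) : FFVal k K →₀ ℤ :=
  (dv H t).mapRange (fun a => max 0 a) (by simp)

/-- the degree of a divisor -/
noncomputable def ffdeg (D : FFVal k K →₀ ℤ) : ℤ := D.sum (fun _ n => n)

@[simp] theorem dv_apply (H : FFin k K) (t : K) (w : FFVal k K) : dv H t w = w.v t := rfl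

@[simp] theorem zd_apply (H : FFin k K) (t : K) (w : FFVal k K) : zd H t w = max 0 (w.v t) := rfl

theorem ffdeg_add (D E : FFVal k K →₀ ℤ) : ffdeg (D + E) = ffdeg D + ffdeg E := by
  unfold ffdeg
  exact Finsupp.sum_add_index' (fun _ => rfl) (fun _ _ _ => rfl)

theorem ffdeg_neg (D : FFVal k K →₀ ℤ) : ffdeg (-D) = -ffdeg D := by
  have := ffdeg_add D (-D)
  have h0 : ffdeg (0 : FFVal k K →₀ ℤ) = 0 := by simp [ffdeg]
  rw [add_neg_cancel, h0] at this
  lia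

theorem ffdeg_sub (D E : FFVal k K →₀ ℤ) : ffdeg (D - E) = ffdeg D - ffdeg E := by
  rw [sub_eq_add_neg, ffdeg_add, ffdeg_neg]; ring

theorem ffdeg_zero : ffdeg (0 : FFVal k K →₀ ℤ) = 0 := by simp [ffdeg]

theorem ffdeg_nsmul (n : ℕ) (D : FFVal k K →₀ ℤ) : ffdeg (n • D) = n * ffdeg D := by
  induction n with
  | zero => simp [ffdeg_zero]
  | succ n ih => rw [succ_nsmul, ffdeg_add, ih]; push_cast; ring

theorem ffdeg_single (w : FFVal k K) (n : ℤ) : ffdeg (Finsupp.single w n) = n := by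
  simp [ffdeg]

theorem ffdeg_nonneg {D : FFVal k K →₀ ℤ} (h : ∀ w, 0 ≤ D w) : 0 ≤ ffdeg D :=
  Finset.sum_nonneg (fun w _ => h w)

theorem ffdeg_mono {D E : FFVal k K →₀ ℤ} (h : ∀ w, D w ≤ E w) : ffdeg D ≤ ffdeg E := by
  have := ffdeg_nonneg (D := E - D) (fun w => by simpa using h w)
  rw [ffdeg_sub] at this; lia

theorem ffdeg_zd_aux (H : FFin k K) {t : K} {n : ℤ} (h : ∃ s : Finset (FFVal k K),
    (∀ w, w ∈ s ↔ 0 < w.v t) ∧ ∑ w ∈ s, w.v t = n) : ffdeg (zd H t) = n := by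
  obtain ⟨s, hs, hn⟩ := h
  rw [← hn]
  have h1 : (zd H t).support = s := by
    ext w
    rw [hs, Finsupp.mem_support_iff, zd_apply]; lia
  unfold ffdeg Finsupp.sum
  rw [h1]
  apply Finset.sum_congr rfl
  intro w hw
  rw [hs] at hw
  rw [zd_apply]; lia

theorem ffdeg_zd (H : FFin k K) {t : K} (ht : t ∉ Set.range (algebraMap k K)) :
    ffdeg (zd H t) = Module.finrank (IntermediateField.adjoin k {t}) K :=
  ffdeg_zd_aux H (ff_count H ht)

theorem ffdeg_zd_inv (H : FFin k K) {t : K} (ht : t ∉ Set.range (algebraMap k K)) :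
    ffdeg (zd H t⁻¹) = Module.finrank (IntermediateField.adjoin k {t}) K :=
  ffdeg_zd_aux H (ff_count_inv H ht)

theorem ffdeg_dv (H : FFin k K) (t : K) : ffdeg (dv H t) = 0 := by
  by_cases ht : t ∈ Set.range (algebraMap k K)
  · obtain ⟨c, rfl⟩ := ht
    have : dv H (algebraMap k K c) = 0 := by
      ext w; simp [FFVal.v_const]
    rw [this, ffdeg_zero]
  · have : dv H t = zd H t - zd H t⁻¹ := by
      ext w
      simp only [dv_apply, Finsupp.coe_sub, Pi.sub_apply, zd_apply, FFVal.v_inv]; lia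
    rw [this, ffdeg_sub, ffdeg_zd H ht, ffdeg_zd_inv H ht, sub_self]

theorem ffHeight_eq (H : FFin k K) (t : K) : ffHeight k t = ffdeg (zd H t⁻¹) := by
  unfold ffHeight ffdeg Finsupp.sum
  rw [← finsum_eq_sum_of_support_subset, ← finsum_neg_distrib]
  · congr 1; funext w
    rw [zd_apply, FFVal.v_inv]; lia
  · intro w hw
    simpa using hw

theorem mem_RR {D : FFVal k K →₀ ℤ} {f : K} :
    f ∈ RRspace k K D ↔ ∀ w : FFVal k K, w.Ge (-D w) f := by
  constructor
  · intro h
    unfold RRspace at h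
    induction h using Submodule.span_induction with
    | mem x hx => intro w h0; exact hx h0 w
    | zero => intro w; exact FFVal.Ge.zero _
    | add x y _ _ hx hy => intro w; exact (hx w).add (hy w)
    | smul c x _ hx => intro w; exact (hx w).smul c
  · intro h
    exact Submodule.subset_span (fun h0 w => h w h0)

theorem RR_neg (H : FFin k K) {D : FFVal k K →₀ ℤ} (hD : ffdeg D < 0) : RRspace k K D = ⊥ := by
  rw [eq_bot_iff]
  intro f hf
  rw [mem_RR] at hf
  rw [Submodule.mem_bot]
  by_contra h0
  have := ffdeg_mono (D := - D) (E := dv H f) (fun w => by simpa using hf w h0)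
  rw [ffdeg_neg, ffdeg_dv] at this
  lia

theorem ff_residue (H : FFin k K) {w : FFVal k K} {t : K} (hw : w.Ge 0 t) :
    ∃ c : k, w.Ge 1 (t - algebraMap k K c) := by
  by_cases ht : t ∈ Set.range (algebraMap k K)
  · obtain ⟨c, rfl⟩ := ht
    exact ⟨c, by rw [sub_self]; exact FFVal.Ge.zero _⟩
  · have := H t ht
    exact adj_residue rfl ht hw

theorem RR_step (H : FFin k K) (D : FFVal k K →₀ ℤ) (w : FFVal k K) :
    ∃ g : K, RRspace k K (D + Finsupp.single w 1) ≤ RRspace k K D ⊔ Submodule.span k {g} := by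
  classical
  by_cases h : RRspace k K (D + Finsupp.single w 1) ≤ RRspace k K D
  · exact ⟨0, h.trans le_sup_left⟩
  obtain ⟨g, hg, hgn⟩ := SetLike.not_le_iff_exists.1 h
  refine ⟨g, ?_⟩
  rw [mem_RR] at hg hgn
  have hg0 : g ≠ 0 := by rintro rfl; exact hgn (fun w => FFVal.Ge.zero _)
  have hoff : ∀ w' : FFVal k K, w' ≠ w → (D + Finsupp.single w 1 : FFVal k K →₀ ℤ) w' = D w' := by
    intro w' hw'
    rw [Finsupp.add_apply, Finsupp.single_eq_of_ne hw', add_zero]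
  have hon : (D + Finsupp.single w 1 : FFVal k K →₀ ℤ) w = D w + 1 := by simp
  have hgw : w.v g = -D w - 1 := by
    have h1 := hg w hg0
    rw [hon] at h1
    by_contra hne
    apply hgn
    intro w' _
    by_cases hw' : w' = w
    · subst hw'; lia
    · have := hg w' hg0
      rwa [hoff w' hw'] at this
  intro f hf
  rw [mem_RR] at hf
  have hq : w.Ge 0 (g⁻¹ * f) := by
    rw [FFVal.ge_mul_iff (inv_ne_zero hg0), FFVal.v_inv]
    refine (hf w).mono ?_
    rw [hon]; lia
  obtain ⟨c, hc⟩ := ff_residue H hq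
  have hfc : f - c • g ∈ RRspace k K D := by
    rw [mem_RR]
    intro w'
    by_cases hw' : w' = w
    · subst hw'
      have : f - c • g = g * (g⁻¹ * f - algebraMap k K c) := by
        rw [Algebra.smul_def]; field_simp
      rw [this, FFVal.ge_mul_iff hg0]
      exact hc.mono (by lia)
    · rw [← hoff w' hw']
      exact (hf w').sub ((hg w').smul c)
  rw [Submodule.mem_sup]
  exact ⟨_, hfc, c • g, Submodule.smul_mem _ _ (Submodule.mem_span_singleton_self g), by ring⟩

theorem RR_finite (H : FFin k K) (w0 : FFVal k K) (D : FFVal k K →₀ ℤ) :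
    FiniteDimensional k (RRspace k K D) := by
  have key : ∀ n : ℕ, ∀ D : FFVal k K →₀ ℤ, ffdeg D < n →
      FiniteDimensional k (RRspace k K D) := by
    intro n
    induction n with
    | zero =>
      intro D hD
      rw [RR_neg H (by simpa using hD)]
      infer_instance
    | succ n ih =>
      intro D hD
      obtain ⟨g, hg⟩ := RR_step H (D - Finsupp.single w0 1) w0
      rw [sub_add_cancel] at hg
      have := ih (D - Finsupp.single w0 1) (by
        rw [ffdeg_sub, ffdeg_single]; push_cast at hD; lia)
      exact Submodule.finiteDimensional_of_le hg
  exact key (ffdeg D + 1).toNat D (by lia)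

theorem RR_mono (H : FFin k K) : ∀ (n : ℕ) {D D' : FFVal k K →₀ ℤ}, (∀ w, D w ≤ D' w) →
    ffdeg (D' - D) = n →
    ffdeg D - Module.finrank k (RRspace k K D) ≤ ffdeg D' - Module.finrank k (RRspace k K D') := by
  intro n
  induction n with
  | zero =>
    intro D D' h hn
    have : D = D' := by
      by_contra hne
      obtain ⟨w, hw⟩ := Finsupp.ne_iff.1 hne
      have := ffdeg_mono (D := Finsupp.single w 1) (E := D' - D) (fun w' => by
        classical
        have h1 := h w'
        rw [Finsupp.single_apply, Finsupp.sub_apply]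
        split_ifs with h2
        · subst h2; lia
        · lia)
      rw [ffdeg_single, hn] at this
      simp at this
    rw [this]
  | succ n ih =>
    intro D D' h hn
    have hne : D ≠ D' := by
      rintro rfl
      rw [sub_self, ffdeg_zero] at hn; push_cast at hn; lia
    obtain ⟨w, hw⟩ := Finsupp.ne_iff.1 hne
    have h1 := ih (D := D) (D' := D' - Finsupp.single w 1) (fun w' => by
        classical
        have h1 := h w'
        rw [Finsupp.sub_apply, Finsupp.single_apply]
        split_ifs with h2
        · subst h2; lia
        · lia) (by
        rw [ffdeg_sub, ffdeg_sub, ffdeg_single]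
        rw [ffdeg_sub] at hn; push_cast at hn; lia)
    obtain ⟨g, hg⟩ := RR_step H (D' - Finsupp.single w 1) w
    rw [sub_add_cancel] at hg
    have := RR_finite H w (D' - Finsupp.single w 1)
    have h2 := Submodule.finrank_mono hg
    have h3 := Submodule.finrank_add_le_finrank_add_finrank (RRspace k K (D' - Finsupp.single w 1))
      (Submodule.span k {g})
    have h4 : Module.finrank k (Submodule.span k {g}) ≤ 1 := by
      simpa using finrank_span_le_card (R := k) ({g} : Set K)
    rw [ffdeg_sub, ffdeg_single] at h1
    lia

end Deg


section Inf
set_option linter.unusedSectionVars false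

variable {k K : Type*} [Field k] [IsAlgClosed k] [CharZero k] [Field K] [Algebra k K]

theorem ge_aeval_inf {w : FFVal k K} {x : K} (hx0 : x ≠ 0) (hw : w.v x ≤ 0) {p : k[X]} {d : ℤ}
    (h : ∀ j, p.coeff j ≠ 0 → (j : ℤ) ≤ d) : w.Ge (d * w.v x) (aeval x p) := by
  rw [aeval_eq_sum_range]
  apply FFVal.Ge.sum
  intro j _
  by_cases hj : p.coeff j = 0
  · rw [hj, zero_smul]; exact FFVal.Ge.zero _
  · apply FFVal.Ge.smul
    intro _
    rw [FFVal.v_pow _ _ hx0]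
    exact mul_le_mul_of_nonpos_right (h j hj) hw

theorem v_aeval_inf {w : FFVal k K} {x : K} (hx0 : x ≠ 0) (hw : w.v x < 0) {p : k[X]}
    (hp : p ≠ 0) : w.v (aeval x p) ≤ p.natDegree * w.v x := by
  by_contra hlt
  push Not at hlt
  have h1 : w.Ge ((p.natDegree - 1 : ℤ) * w.v x) (aeval x (p.erase p.natDegree)) := by
    apply ge_aeval_inf hx0 hw.le
    intro j hj
    rw [coeff_erase] at hj
    split_ifs at hj with h
    · exact absurd rfl hj
    · have := le_natDegree_of_ne_zero hj
      lia
  have h2 : aeval x p - aeval x (p.erase p.natDegree) = p.leadingCoeff • x ^ p.natDegree := by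
    have h := congrArg (aeval x) (monomial_add_erase p p.natDegree)
    rw [map_add, aeval_monomial, coeff_natDegree] at h
    rw [Algebra.smul_def, ← h]
    ring
  have h3 : w.Ge (p.natDegree * w.v x + 1) (aeval x p - aeval x (p.erase p.natDegree)) := by
    refine FFVal.Ge.sub (fun _ => hlt) (h1.mono ?_)
    rw [sub_mul]; lia
  rw [h2] at h3
  have hlc : algebraMap k K p.leadingCoeff ≠ 0 := by
    simpa using hp
  have h4 := h3 (by rw [Algebra.smul_def]; exact mul_ne_zero hlc (pow_ne_zero _ hx0))
  rw [Algebra.smul_def, w.map_mul _ _ hlc (pow_ne_zero _ hx0), FFVal.v_const, FFVal.v_pow _ _ hx0]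
    at h4
  lia

theorem aeval_ne {x : K} (hx : x ∉ Set.range (algebraMap k K)) {p : k[X]} (hp : p ≠ 0) :
    aeval x p ≠ 0 := by
  intro h
  exact hp (transcendental_iff.1 (ff_transc hx) p h)

theorem notMem_range_ne_zero {x : K} (hx : x ∉ Set.range (algebraMap k K)) : x ≠ 0 := by
  rintro rfl; exact hx ⟨0, by simp⟩

theorem ff_Q (H : FFin k K) {x : K} (hx : x ∉ Set.range (algebraMap k K)) (D : FFVal k K →₀ ℤ) :
    ∃ p : k[X], p ≠ 0 ∧ ∃ m : ℕ, ∀ w : FFVal k K,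
      D w ≤ m * zd H x⁻¹ w + w.v (aeval x p) := by
  have hx0 := notMem_range_ne_zero hx
  have hz : ∀ w : FFVal k K, 0 ≤ zd H x⁻¹ w := fun w => by rw [zd_apply]; lia
  induction D using Finsupp.induction_linear with
  | zero => exact ⟨1, one_ne_zero, 0, fun w => by simp [FFVal.v_one]⟩
  | add D E hD hE =>
    obtain ⟨p, hp, m, h⟩ := hD
    obtain ⟨q, hq, m', h'⟩ := hE
    refine ⟨p * q, mul_ne_zero hp hq, m + m', fun w => ?_⟩
    rw [_root_.map_mul, w.map_mul _ _ (aeval_ne hx hp) (aeval_ne hx hq), Finsupp.add_apply]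
    have := h w
    have := h' w
    push_cast
    rw [add_mul]; lia
  | single w0 a =>
    by_cases ha : a ≤ 0
    · refine ⟨1, one_ne_zero, 0, fun w => ?_⟩
      classical
      rw [Finsupp.single_apply]
      simp only [map_one, FFVal.v_one]
      split_ifs <;> simp [ha]
    push Not at ha
    lift a to ℕ using ha.le
    by_cases hw : w0.v x < 0
    · refine ⟨1, one_ne_zero, a, fun w => ?_⟩
      classical
      rw [Finsupp.single_apply]
      simp only [map_one, FFVal.v_one]
      split_ifs with h
      · subst h
        have : (1 : ℤ) ≤ zd H x⁻¹ w0 := by rw [zd_apply, FFVal.v_inv]; lia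
        nlinarith
      · have := hz w; positivity
    · obtain ⟨c, hc⟩ := ff_residue H (w := w0) (t := x) (fun _ => by lia)
      have hne : x - algebraMap k K c ≠ 0 := fun h => hx ⟨c, (sub_eq_zero.1 h).symm⟩
      refine ⟨(X - C c) ^ a, pow_ne_zero _ (X_sub_C_ne_zero c), a, fun w => ?_⟩
      have he : aeval x ((X - C c) ^ a) = (x - algebraMap k K c) ^ a := by simp
      rw [he, FFVal.v_pow _ _ hne, ← mul_add]
      classical
      rw [Finsupp.single_apply]
      have h1 := (FFVal.Ge.sub (w := w) (n := min 0 (w.v x)) (f := x) (g := algebraMap k K c)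
        (fun _ => by lia) ((FFVal.Ge.const c).mono (by lia))) hne
      split_ifs with h
      · subst h
        have := hc hne
        have := hz w0
        nlinarith
      · apply mul_nonneg (by positivity)
        rw [zd_apply, FFVal.v_inv]; lia

end Inf


section Red
set_option linter.unusedSectionVars false

variable {k K : Type*} [Field k] [IsAlgClosed k] [CharZero k] [Field K] [Algebra k K]

/-- the space `L(m D_∞)` where `D_∞` is the polar divisor of `x` -/
noncomputable def VV (H : FFin k K) (x : K) (m : ℤ) : Submodule k K :=
  RRspace k K (m • zd H x⁻¹)

theorem mem_VV (H : FFin k K) {x : K} {m : ℤ} {f : K} : f ∈ VV H x m ↔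
    (∀ w : FFVal k K, 0 ≤ w.v x → w.Ge 0 f) ∧
    (∀ w : FFVal k K, w.v x < 0 → w.Ge (m * w.v x) f) := by
  unfold VV
  rw [mem_RR]
  have h0 : ∀ w : FFVal k K, 0 ≤ w.v x → -(m • zd H x⁻¹) w = 0 := by
    intro w hw
    rw [Finsupp.smul_apply, zd_apply, FFVal.v_inv, max_eq_left (by lia)]; simp
  have h1 : ∀ w : FFVal k K, w.v x < 0 → -(m • zd H x⁻¹) w = m * w.v x := by
    intro w hw
    rw [Finsupp.smul_apply, zd_apply, FFVal.v_inv, max_eq_right (by lia)]; simp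
  constructor
  · intro h
    exact ⟨fun w hw => by rw [← h0 w hw]; exact h w, fun w hw => by rw [← h1 w hw]; exact h w⟩
  · rintro ⟨ha, hb⟩ w
    by_cases hw : 0 ≤ w.v x
    · rw [h0 w hw]; exact ha w hw
    · push Not at hw
      rw [h1 w hw]; exact hb w hw

theorem VV_neg (H : FFin k K) {x : K} (hx : x ∉ Set.range (algebraMap k K)) {m : ℤ} (hm : m < 0) :
    VV H x m = ⊥ := by
  apply RR_neg H
  have := H x hx
  have h1 : ffdeg (m • zd H x⁻¹) = -(((-m).toNat : ℤ) * ffdeg (zd H x⁻¹)) := by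
    rw [← ffdeg_nsmul, ← ffdeg_neg]
    congr 1
    ext w
    simp only [Finsupp.smul_apply, Finsupp.neg_apply, smul_eq_mul, nsmul_eq_mul]
    have : (((-m).toNat : ℕ) : ℤ) = -m := by lia
    rw [this]; ring
  rw [h1, ffdeg_zd_inv H hx]
  have h2 : 0 < Module.finrank (IntermediateField.adjoin k {x}) K := Module.finrank_pos
  have h3 : (0 : ℤ) < (-m).toNat := by lia
  have : (0 : ℤ) < ((-m).toNat : ℤ) * Module.finrank (IntermediateField.adjoin k {x}) K := by
    positivity
  lia

/-- a reduced system of generators -/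
structure Red (H : FFin k K) (x : K) {ι : Type} [Fintype ι] (f : ι → K) (m : ι → ℕ) : Prop where
  li : LinearIndependent (IntermediateField.adjoin k {x}) f
  mem : ∀ i, f i ∈ VV H x (m i)
  min : ∀ (f' : ι → K) (m' : ι → ℕ), LinearIndependent (IntermediateField.adjoin k {x}) f' →
    (∀ i, f' i ∈ VV H x (m' i)) → ∑ i, m i ≤ ∑ i, m' i

theorem aeval_mem_adj (x : K) (p : k[X]) : aeval x p ∈ IntermediateField.adjoin k {x} := by
  have := (aeval (R := k) (⟨x, IntermediateField.mem_adjoin_simple_self k x⟩ :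
    IntermediateField.adjoin k {x}) p).2
  convert! this using 1
  have := aeval_algebraMap_apply (R := k) (A := IntermediateField.adjoin k {x}) K
    (⟨x, IntermediateField.mem_adjoin_simple_self k x⟩) p
  exact this

theorem red_exists (H : FFin k K) {x : K} (hx : x ∉ Set.range (algebraMap k K)) :
    ∃ (f : Fin (Module.finrank (IntermediateField.adjoin k {x}) K) → K)
      (m : Fin (Module.finrank (IntermediateField.adjoin k {x}) K) → ℕ), Red H x f m := by
  classical
  have := H x hx
  let b := Module.finBasis (IntermediateField.adjoin k {x}) K
  have h1 : ∀ i, ∃ p : k[X], p ≠ 0 ∧ ∃ m : ℕ, aeval x p * b i ∈ VV H x m := by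
    intro i
    obtain ⟨p, hp, m, h⟩ := ff_Q H hx (- dv H (b i))
    refine ⟨p, hp, m, ?_⟩
    unfold VV
    rw [mem_RR]
    intro w _
    rw [w.map_mul _ _ (aeval_ne hx hp) (b.ne_zero i)]
    have := h w
    simp only [Finsupp.neg_apply, dv_apply] at this
    simp only [Finsupp.smul_apply, smul_eq_mul]
    lia
  choose p hp m hm using h1
  let u : ∀ i : Fin (Module.finrank (IntermediateField.adjoin k {x}) K),
      (IntermediateField.adjoin k {x})ˣ := fun i =>
    Units.mk0 ⟨aeval x (p i), aeval_mem_adj x (p i)⟩ (fun h => aeval_ne hx (hp i)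
      (congrArg Subtype.val h))
  have hli := b.linearIndependent.units_smul u
  have hex : ∃ N : ℕ, ∃ (f : Fin (Module.finrank (IntermediateField.adjoin k {x}) K) → K)
      (m : Fin (Module.finrank (IntermediateField.adjoin k {x}) K) → ℕ),
      LinearIndependent (IntermediateField.adjoin k {x}) f ∧ (∀ i, f i ∈ VV H x (m i)) ∧
      ∑ i, m i = N := ⟨_, _, m, hli, fun i => hm i, rfl⟩
  obtain ⟨f, m, h1, h2, h3⟩ := Nat.find_spec hex
  refine ⟨f, m, h1, h2, fun f' m' h1' h2' => ?_⟩
  rw [h3]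
  exact Nat.find_min' hex ⟨f', m', h1', h2', rfl⟩

theorem Red.swap {H : FFin k K} {x : K} (hx : x ∉ Set.range (algebraMap k K))
    {ι : Type} [Fintype ι] {f : ι → K} {m : ι → ℕ} (h : Red H x f m)
    (c : ι → IntermediateField.adjoin k {x}) (i : ι) (hi : c i ≠ 0) {m' : ℤ}
    (hg : ∑ j, c j • f j ∈ VV H x m') : (m i : ℤ) ≤ m' := by
  classical
  by_contra hlt
  push Not at hlt
  by_cases hm' : m' < 0
  · rw [VV_neg H hx hm', Submodule.mem_bot] at hg
    exact hi (Fintype.linearIndependent_iff.1 h.li c hg i)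
  push Not at hm'
  lift m' to ℕ using hm'
  have hli := h.li.update i (∑ j, c j • f j) ⟨1, one_mem _, Finsupp.equivFunOnFinite.symm c,
    by simpa using hi, by
      rw [one_smul, Finsupp.linearCombination_apply, Finsupp.sum_fintype _ _ (by simp)]
      simp⟩
  have := h.min _ (Function.update m i m') hli (by
    intro j
    by_cases hj : j = i
    · subst hj; simpa using hg
    · simpa [Function.update_of_ne hj] using h.mem j)
  have h2 : ∑ j, Function.update m i m' j < ∑ j, m j := by
    apply Finset.sum_lt_sum
    · intro j _
      by_cases hj : j = i
      · subst hj; simp; lia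
      · simp [Function.update_of_ne hj]
    · exact ⟨i, Finset.mem_univ i, by simp; lia⟩
  lia

end Red


section Steps
set_option linter.unusedSectionVars false

variable {k K : Type*} [Field k] [IsAlgClosed k] [CharZero k] [Field K] [Algebra k K]

/-- a polynomial in `x` as an element of `k(x)` -/
noncomputable def pol (x : K) (p : k[X]) : IntermediateField.adjoin k {x} :=
  ⟨aeval x p, aeval_mem_adj x p⟩

theorem pol_smul (x : K) (p : k[X]) (f : K) : pol x p • f = aeval x p * f := rfl

theorem pol_ne {x : K} (hx : x ∉ Set.range (algebraMap k K)) {p : k[X]} (hp : p ≠ 0) :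
    pol x p ≠ 0 := fun h => aeval_ne hx hp (congrArg Subtype.val h)

theorem adj_denom {x : K} (hx : x ∉ Set.range (algebraMap k K)) {ι : Type} [Fintype ι]
    (c : ι → IntermediateField.adjoin k {x}) :
    ∃ b : k[X], b ≠ 0 ∧ ∀ i, ∃ a : k[X], pol x b * c i = pol x a := by
  obtain ⟨i1, i2, i3, i4, i5, h⟩ := adj_setup (IntermediateField.adjoin k {x}) x rfl hx
  obtain ⟨b, hb⟩ := IsLocalization.exist_integer_multiples_of_finite (nonZeroDivisors k[X]) c
  have hal : ∀ p, algebraMap k[X] (IntermediateField.adjoin k {x}) p = pol x p := by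
    intro p
    apply Subtype.ext
    have := IsScalarTower.algebraMap_apply k[X] (IntermediateField.adjoin k {x}) K p
    rw [h] at this
    exact this.symm
  refine ⟨b, nonZeroDivisors.ne_zero b.2, fun i => ?_⟩
  obtain ⟨a, ha⟩ := hb i
  refine ⟨a, ?_⟩
  rw [← hal, ← hal, ha, Algebra.smul_def]

theorem Red.step1 {H : FFin k K} {x : K} (hx : x ∉ Set.range (algebraMap k K))
    {ι : Type} [Fintype ι] {f : ι → K} {m : ι → ℕ} (h : Red H x f m)
    (c : ι → IntermediateField.adjoin k {x}) {d : ℤ}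
    (hg : ∑ j, c j • f j ∈ VV H x d) : ∀ i, ∃ p : k[X], c i = pol x p := by
  classical
  have hx0 := notMem_range_ne_zero hx
  obtain ⟨b, hb, hc⟩ := adj_denom hx c
  choose a ha using hc
  have hb0 := pol_ne hx hb
  have hb0' := aeval_ne hx hb
  let r : ι → IntermediateField.adjoin k {x} := fun i => pol x (a i % b) / pol x b
  have hcr : ∀ i, c i = pol x (a i / b) + r i := by
    intro i
    have h1 : pol x (a i) = pol x b * pol x (a i / b) + pol x (a i % b) := by
      apply Subtype.ext
      change aeval x (a i) = aeval x b * aeval x (a i / b) + aeval x (a i % b)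
      rw [← _root_.map_mul, ← map_add, EuclideanDomain.div_add_mod]
    have h2 := ha i
    rw [h1] at h2
    simp only [r]
    field_simp
    linear_combination h2
  by_contra hcon
  push Not at hcon
  obtain ⟨i0, hi0⟩ := hcon
  let A : Finset ι := Finset.univ.filter (fun i => a i % b ≠ 0)
  have hA : A.Nonempty := by
    refine ⟨i0, ?_⟩
    simp only [A, Finset.mem_filter, Finset.mem_univ, true_and]
    intro h0
    apply hi0 (a i0 / b)
    rw [hcr i0]
    simp only [r, h0]
    have : pol x (0 : k[X]) = 0 := Subtype.ext (by simp [pol])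
    rw [this]; simp
  obtain ⟨i, hiA, hi⟩ := Finset.exists_max_image A m hA
  simp only [A, Finset.mem_filter, Finset.mem_univ, true_and] at hiA hi
  have hri : r i ≠ 0 := div_ne_zero (pol_ne hx hiA) hb0
  have hmem : ∑ j, r j • f j ∈ VV H x (m i - 1) := by
    rw [mem_VV] at hg ⊢
    constructor
    · intro w hw
      have : ∑ j, r j • f j = ∑ j, c j • f j - ∑ j, aeval x (a j / b) * f j := by
        rw [← Finset.sum_sub_distrib]
        apply Finset.sum_congr rfl
        intro j _
        rw [hcr j, add_smul, pol_smul]; ring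
      rw [this]
      refine (hg.1 w hw).sub (FFVal.Ge.sum (fun j _ => ?_))
      have h1 : w.Ge 0 x := fun _ => hw
      have h2 := ((mem_VV H).1 (h.mem j)).1 w hw
      simpa using (h1.aeval (a j / b)).mul h2
    · intro w hw
      apply FFVal.Ge.sum
      intro j _
      by_cases hj : a j % b = 0
      · have : r j • f j = 0 := by
          change (aeval x (a j % b) / aeval x b) * f j = 0
          rw [hj]; simp
        rw [this]; exact FFVal.Ge.zero _
      have h1 : r j • f j = (aeval x b)⁻¹ * (aeval x (a j % b) * f j) := by
        change (aeval x (a j % b) / aeval x b) * f j = _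
        field_simp
      rw [h1, FFVal.ge_mul_iff (inv_ne_zero hb0'), FFVal.v_inv]
      have h2 := ((mem_VV H).1 (h.mem j)).2 w hw
      have hdeg : (a j % b).natDegree < b.natDegree := 
        natDegree_lt_natDegree hj (EuclideanDomain.mod_lt _ hb)
      have h3 : w.Ge ((b.natDegree - 1 : ℤ) * w.v x) (aeval x (a j % b)) := by
        apply ge_aeval_inf hx0 hw.le
        intro l hl
        have := le_natDegree_of_ne_zero hl
        lia
      refine (h3.mul h2).mono ?_
      have h4 := v_aeval_inf hx0 hw hb
      have h5 := hi j hj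
      have h6 : (m i : ℤ) * w.v x ≤ m j * w.v x :=
        mul_le_mul_of_nonpos_right (by exact_mod_cast h5) hw.le
      rw [sub_mul, sub_mul]; lia
  have := h.swap hx r i hri hmem
  lia

theorem Red.step2 {H : FFin k K} {x : K} (hx : x ∉ Set.range (algebraMap k K))
    {ι : Type} [Fintype ι] {f : ι → K} {m : ι → ℕ} (h : Red H x f m)
    (p : ι → k[X]) {d : ℤ} {M : ℕ} (hM : d < M)
    (hp : ∀ i j, (p i).coeff j ≠ 0 → j + m i ≤ M)
    (hg : ∑ j, aeval x (p j) * f j ∈ VV H x d) :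
    ∀ i j, (p i).coeff j ≠ 0 → j + m i < M := by
  classical
  have hx0 := notMem_range_ne_zero hx
  by_contra hcon
  push Not at hcon
  obtain ⟨i0, j0, hij, hij'⟩ := hcon
  let A : Finset ι := Finset.univ.filter (fun i => m i ≤ M ∧ (p i).coeff (M - m i) ≠ 0)
  have hA : A.Nonempty := by
    refine ⟨i0, ?_⟩
    simp only [A, Finset.mem_filter, Finset.mem_univ, true_and]
    have := hp i0 j0 hij
    have h2 : M - m i0 = j0 := by lia
    rw [h2]
    exact ⟨by lia, hij⟩
  obtain ⟨i, hiA, hi⟩ := Finset.exists_max_image A m hA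
  have hiA' := hiA
  simp only [A, Finset.mem_filter, Finset.mem_univ, true_and] at hiA'
  let q : ι → k[X] := fun l =>
    if l ∈ A then C ((p l).coeff (M - m l)) * X ^ (m i - m l) else 0
  have hqi : q i ≠ 0 := by
    simp only [q, hiA, if_true]
    exact mul_ne_zero (by simpa using hiA'.2) (pow_ne_zero _ X_ne_zero)
  have hsum : x ^ (M - m i) * ∑ l, pol x (q l) • f l =
      ∑ l, aeval x (p l) * f l - ∑ l, aeval x ((p l).erase (M - m l)) * f l := by
    rw [← Finset.sum_sub_distrib, Finset.mul_sum]
    apply Finset.sum_congr rfl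
    intro l _
    have h1 := congrArg (aeval x) (monomial_add_erase (p l) (M - m l))
    rw [map_add, aeval_monomial] at h1
    rw [pol_smul, ← h1]
    by_cases hl : l ∈ A
    · have h2 : M - m l = (M - m i) + (m i - m l) := by
        have := hi l hl
        have := hiA'.1
        lia
      simp only [q, hl, if_true, _root_.map_mul, aeval_C, map_pow, aeval_X]
      conv_rhs => rw [h2, pow_add, ← h2]
      ring
    · have h2 : (p l).coeff (M - m l) = 0 := by
        by_contra hne
        apply hl
        simp only [A, Finset.mem_filter, Finset.mem_univ, true_and]
        have := hp l _ hne
        exact ⟨by lia, hne⟩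
      simp [q, hl, h2]
  have hmem : ∑ l, pol x (q l) • f l ∈ VV H x (m i - 1) := by
    rw [mem_VV]
    constructor
    · intro w hw
      refine (FFVal.Ge.sum (fun j _ => ?_))
      have h1 : w.Ge 0 x := fun _ => hw
      have h2 := ((mem_VV H).1 (h.mem j)).1 w hw
      rw [pol_smul]
      simpa using (h1.aeval (q j)).mul h2
    · intro w hw
      have h1 : w.Ge ((M - 1 : ℤ) * w.v x) (x ^ (M - m i) * ∑ l, pol x (q l) • f l) := by
        rw [hsum]
        apply FFVal.Ge.sub
        · refine (((mem_VV H).1 hg).2 w hw).mono ?_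
          exact mul_le_mul_of_nonpos_right (by lia) hw.le
        · refine FFVal.Ge.sum (fun l _ => ?_)
          have h2 := ((mem_VV H).1 (h.mem l)).2 w hw
          have h3 : w.Ge ((M - m l - 1 : ℤ) * w.v x) (aeval x ((p l).erase (M - m l))) := by
            apply ge_aeval_inf hx0 hw.le
            intro j hj
            rw [coeff_erase] at hj
            split_ifs at hj with hjM
            · exact absurd rfl hj
            · have := hp l j hj
              lia
          refine (h3.mul h2).mono ?_
          rw [← add_mul]
          exact mul_le_mul_of_nonpos_right (by lia) hw.le
      rw [FFVal.ge_mul_iff (pow_ne_zero _ hx0), FFVal.v_pow _ _ hx0] at h1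
      refine h1.mono ?_
      rw [← sub_mul]
      have := hiA'.1
      exact mul_le_mul_of_nonpos_right (by lia) hw.le
  have := h.swap hx (fun l => pol x (q l)) i (pol_ne hx hqi) hmem
  lia

theorem Red.step {H : FFin k K} {x : K} (hx : x ∉ Set.range (algebraMap k K))
    {ι : Type} [Fintype ι] {f : ι → K} {m : ι → ℕ} (h : Red H x f m)
    (p : ι → k[X]) {d : ℕ}
    (hg : ∑ j, aeval x (p j) * f j ∈ VV H x d) :
    ∀ i j, (p i).coeff j ≠ 0 → j + m i ≤ d := by
  have key : ∀ e : ℕ, (∀ i j, (p i).coeff j ≠ 0 → j + m i ≤ d + e) →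
      ∀ i j, (p i).coeff j ≠ 0 → j + m i ≤ d := by
    intro e
    induction e with
    | zero => intro h1; simpa using h1
    | succ e ih =>
      intro h1
      apply ih
      intro i j hij
      have := h.step2 hx p (d := d) (M := d + (e + 1)) (by push_cast; lia) h1 hg i j hij
      lia
  apply key (∑ i, ((p i).natDegree + m i))
  intro i j hij
  have h1 := le_natDegree_of_ne_zero hij
  have h2 := Finset.single_le_sum (f := fun i => (p i).natDegree + m i)
    (fun _ _ => Nat.zero_le _) (Finset.mem_univ i)
  lia

end Steps


section Dims
set_option linter.unusedSectionVars false

variable {k K : Type*} [Field k] [IsAlgClosed k] [CharZero k] [Field K] [Algebra k K]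

/-- the map sending a tuple of polynomials `p i` to `∑ p i (x) f i` -/
noncomputable def phi (x : K) {ι : Type} [Fintype ι] (f : ι → K) (e : ι → ℕ) :
    (∀ i, degreeLT k (e i)) →ₗ[k] K :=
  ∑ i, (LinearMap.mulRight k (f i)) ∘ₗ (aeval x).toLinearMap ∘ₗ (degreeLT k (e i)).subtype ∘ₗ
    LinearMap.proj i

theorem phi_apply (x : K) {ι : Type} [Fintype ι] (f : ι → K) (e : ι → ℕ)
    (p : ∀ i, degreeLT k (e i)) : phi x f e p = ∑ i, aeval x (p i : k[X]) * f i := by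
  simp [phi]

theorem finite_degreeLT (e : ℕ) : Module.Finite k (degreeLT k e) :=
  Module.Finite.equiv (degreeLTEquiv k e).symm

theorem finrank_dom {ι : Type} [Fintype ι] (e : ι → ℕ) :
    Module.finrank k (∀ i, degreeLT k (e i)) = ∑ i, e i := by
  have := fun i => finite_degreeLT (k := k) (e i)
  rw [Module.finrank_pi_fintype]
  apply Finset.sum_congr rfl
  intro i _
  rw [(degreeLTEquiv k (e i)).finrank_eq]; simp

theorem phi_inj {x : K} (hx : x ∉ Set.range (algebraMap k K)) {ι : Type} [Fintype ι] {f : ι → K}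
    (hf : LinearIndependent (IntermediateField.adjoin k {x}) f) (e : ι → ℕ) :
    Function.Injective (phi (k := k) x f e) := by
  rw [injective_iff_map_eq_zero]
  intro p hp
  rw [phi_apply] at hp
  have := Fintype.linearIndependent_iff.1 hf (fun i => pol x (p i : k[X])) hp
  funext i
  apply Subtype.ext
  by_contra hne
  exact pol_ne hx hne (this i)

theorem place_inf (H : FFin k K) {x : K} (hx : x ∉ Set.range (algebraMap k K)) :
    ∃ w : FFVal k K, w.v x < 0 := by
  have := H x hx
  obtain ⟨s, hs, hn⟩ := ff_count_inv H hx
  have h2 : 0 < Module.finrank (IntermediateField.adjoin k {x}) K := Module.finrank_pos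
  have : s.Nonempty := by
    by_contra h
    rw [Finset.not_nonempty_iff_eq_empty] at h
    rw [h, Finset.sum_empty] at hn
    lia
  obtain ⟨w, hw⟩ := this
  rw [hs, FFVal.v_inv] at hw
  exact ⟨w, by lia⟩

theorem ell_lower {H : FFin k K} {x : K} (hx : x ∉ Set.range (algebraMap k K))
    {ι : Type} [Fintype ι] {f : ι → K} {m : ι → ℕ} (h : Red H x f m) (d : ℕ) :
    ∑ i, (d + 1 - m i) ≤ Module.finrank k (VV H x d) := by
  have hx0 := notMem_range_ne_zero hx
  obtain ⟨w0, _⟩ := place_inf H hx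
  have : FiniteDimensional k (VV H x d) := RR_finite H w0 _
  have h1 : LinearMap.range (phi x f (fun i => d + 1 - m i)) ≤ VV H x d := by
    rintro _ ⟨p, rfl⟩
    rw [phi_apply]
    apply Submodule.sum_mem
    intro i _
    by_cases hi : m i ≤ d
    swap
    · have : (p i : k[X]) = 0 := by
        have h1 := mem_degreeLT.1 (p i).2
        rw [degree_lt_iff_coeff_zero] at h1
        ext j
        exact h1 j (by lia)
      rw [this]; simp
    rw [mem_VV]
    have h2 := (mem_VV H).1 (h.mem i)
    constructor
    · intro w hw
      have h1 : w.Ge 0 x := fun _ => hw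
      simpa using (h1.aeval (p i : k[X])).mul (h2.1 w hw)
    · intro w hw
      have h3 : w.Ge ((d - m i : ℤ) * w.v x) (aeval x (p i : k[X])) := by
        apply ge_aeval_inf hx0 hw.le
        intro j hj
        have h4 := mem_degreeLT.1 (p i).2
        have h5 := (le_degree_of_ne_zero hj).trans_lt h4
        have h6 : j < d + 1 - m i := by exact_mod_cast h5
        lia
      refine (h3.mul (h2.2 w hw)).mono ?_
      rw [← add_mul]; simp
  have h2 := Submodule.finrank_mono h1
  rwa [LinearMap.finrank_range_of_inj (phi_inj hx h.li _), finrank_dom] at h2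

theorem ell_upper {H : FFin k K} {x : K} (hx : x ∉ Set.range (algebraMap k K))
    {ι : Type} [Fintype ι] {f : ι → K} {m : ι → ℕ} (h : Red H x f m)
    (hcard : Fintype.card ι = Module.finrank (IntermediateField.adjoin k {x}) K) (d : ℕ) :
    Module.finrank k (VV H x d) ≤ ∑ i, (d + 1 - m i) := by
  have := fun i => finite_degreeLT (k := k) (d + 1 - m i)
  have := H x hx
  have hne : Nonempty ι := by
    rw [← Fintype.card_pos_iff, hcard]; exact Module.finrank_pos
  let b := basisOfLinearIndependentOfCardEqFinrank h.li hcard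
  have h1 : VV H x d ≤ LinearMap.range (phi x f (fun i => d + 1 - m i)) := by
    intro g hg
    have hsum := b.sum_repr g
    simp only [b, coe_basisOfLinearIndependentOfCardEqFinrank] at hsum
    rw [← hsum] at hg
    have hp := h.step1 hx _ hg
    choose p hp using hp
    simp only [hp, pol_smul] at hsum hg
    have hdeg := h.step hx p hg
    refine ⟨fun i => ⟨p i, ?_⟩, ?_⟩
    · rw [mem_degreeLT, degree_lt_iff_coeff_zero]
      intro j hj
      by_contra hne
      have := hdeg i j hne
      lia
    · rw [phi_apply]; exact hsum
  rw [← finrank_dom (k := k) (fun i => d + 1 - m i)]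
  exact (Submodule.finrank_mono h1).trans (LinearMap.finrank_range_le _)

theorem genus_bdd {H : FFin k K} {x : K} (hx : x ∉ Set.range (algebraMap k K))
    {ι : Type} [Fintype ι] {f : ι → K} {m : ι → ℕ} (h : Red H x f m)
    (hcard : Fintype.card ι = Module.finrank (IntermediateField.adjoin k {x}) K)
    (D : FFVal k K →₀ ℤ) :
    ffdeg D + 1 - Module.finrank k (RRspace k K D) ≤ 1 + ∑ i, (m i : ℤ) := by
  obtain ⟨p, hp, d, hd⟩ := ff_Q H hx D
  have hp0 := aeval_ne hx hp
  obtain ⟨w0, _⟩ := place_inf H hx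
  let E : FFVal k K →₀ ℤ := d • zd H x⁻¹ + dv H (aeval x p)
  have hDE : ∀ w, D w ≤ E w := fun w => by simpa [E] using hd w
  have h1 := RR_mono H (ffdeg (E - D)).toNat hDE (by
    have := ffdeg_nonneg (D := E - D) (fun w => by simpa using hDE w)
    lia)
  have hE : ffdeg E = d * Module.finrank (IntermediateField.adjoin k {x}) K := by
    simp only [E]
    rw [ffdeg_add, ffdeg_nsmul, ffdeg_dv, ffdeg_zd_inv H hx, add_zero]
  have := RR_finite H w0 E
  have h2 : (VV H x d).map (LinearMap.mulLeft k (aeval x p)⁻¹) ≤ RRspace k K E := by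
    rintro _ ⟨g, hg, rfl⟩
    have hg' := mem_RR.1 hg
    rw [mem_RR]
    intro w
    rw [LinearMap.mulLeft_apply, FFVal.ge_mul_iff (inv_ne_zero hp0), FFVal.v_inv]
    refine (hg' w).mono ?_
    simp only [E, Finsupp.add_apply, Finsupp.smul_apply, dv_apply, nsmul_eq_mul, smul_eq_mul]
    lia
  have h3 := Submodule.finrank_mono h2
  rw [← (Submodule.equivMapOfInjective (LinearMap.mulLeft k (aeval x p)⁻¹)
    (mul_right_injective₀ (inv_ne_zero hp0)) (VV H x d)).finrank_eq] at h3
  have h4 := ell_lower hx h d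
  have h5 : (d : ℤ) * Fintype.card ι - ∑ i, (m i : ℤ) ≤ ((∑ i, (d + 1 - m i) : ℕ) : ℤ) := by
    push_cast
    have : (d : ℤ) * Fintype.card ι = ∑ i : ι, (d : ℤ) := by simp [mul_comm]
    rw [this, ← Finset.sum_sub_distrib]
    apply Finset.sum_le_sum
    intro i _
    lia
  rw [hcard] at h5
  lia

theorem genus_ge {H : FFin k K} {x : K} (hx : x ∉ Set.range (algebraMap k K))
    {ι : Type} [Fintype ι] {f : ι → K} {m : ι → ℕ} (h : Red H x f m)
    (hcard : Fintype.card ι = Module.finrank (IntermediateField.adjoin k {x}) K)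
    (D : FFVal k K →₀ ℤ) :
    ffdeg D + 1 - Module.finrank k (RRspace k K D) ≤ ffGenus k K := by
  unfold ffGenus
  apply le_csSup
  · refine ⟨1 + ∑ i, (m i : ℤ), ?_⟩
    rintro _ ⟨D, rfl⟩
    exact genus_bdd hx h hcard D
  · exact ⟨D, rfl⟩

theorem genus_ge_one {H : FFin k K} {x : K} (hx : x ∉ Set.range (algebraMap k K))
    {ι : Type} [Fintype ι] {f : ι → K} {m : ι → ℕ} (h : Red H x f m)
    (hcard : Fintype.card ι = Module.finrank (IntermediateField.adjoin k {x}) K) :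
    1 - (Module.finrank (IntermediateField.adjoin k {x}) K : ℤ) + ∑ i, (m i : ℤ)
      ≤ ffGenus k K := by
  let d := ∑ i, m i
  have h1 := genus_ge hx h hcard (((d : ℕ) : ℤ) • zd H x⁻¹)
  have h2 := ell_upper hx h hcard d
  have h3 : ((∑ i, (d + 1 - m i) : ℕ) : ℤ) =
      (d + 1) * Module.finrank (IntermediateField.adjoin k {x}) K - ∑ i, (m i : ℤ) := by
    rw [← hcard]
    have : ((d : ℤ) + 1) * Fintype.card ι = ∑ i : ι, ((d : ℤ) + 1) := by simp [mul_comm]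
    rw [this, ← Finset.sum_sub_distrib]
    push_cast
    apply Finset.sum_congr rfl
    intro i _
    have : m i ≤ d := Finset.single_le_sum (f := m) (fun _ _ => Nat.zero_le _) (Finset.mem_univ i)
    lia
  have h4 : ffdeg (((d : ℕ) : ℤ) • zd H x⁻¹) =
      d * Module.finrank (IntermediateField.adjoin k {x}) K := by
    rw [natCast_zsmul, ffdeg_nsmul, ffdeg_zd_inv H hx]
  rw [h4] at h1
  unfold VV at h2
  have h5 : (Module.finrank k (RRspace k K (((d : ℕ) : ℤ) • zd H x⁻¹)) : ℤ) ≤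
    ((∑ i, (d + 1 - m i) : ℕ) : ℤ) := by exact_mod_cast h2
  rw [h3, add_mul] at h5
  lia

end Dims


section Trace
set_option linter.unusedSectionVars false

variable {k K : Type*} [Field k] [IsAlgClosed k] [CharZero k] [Field K] [Algebra k K]

theorem adj_one_sub {x y : K} (hxy : x + y = 1) :
    IntermediateField.adjoin k {x} = IntermediateField.adjoin k {y} := by
  apply le_antisymm
  · rw [IntermediateField.adjoin_simple_le_iff, show x = 1 - y by linear_combination hxy]
    exact sub_mem (one_mem _) (IntermediateField.mem_adjoin_simple_self k y)
  · rw [IntermediateField.adjoin_simple_le_iff, show y = 1 - x by linear_combination hxy]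
    exact sub_mem (one_mem _) (IntermediateField.mem_adjoin_simple_self k x)

theorem unit_vals {x y : K} (hx0 : x ≠ 0) (hy0 : y ≠ 0) (hxy : x + y = 1) (w : FFVal k K) :
    min (w.v x) (w.v y) ≤ 0 ∧ min 0 (w.v y) ≤ w.v x ∧ min 0 (w.v x) ≤ w.v y := by
  have h1 := w.add_min x y hx0 hy0 (by rw [hxy]; exact one_ne_zero)
  have hx : x = 1 + -y := by linear_combination hxy
  have hy : y = 1 + -x := by linear_combination hxy
  have h2 := w.add_min 1 (-y) one_ne_zero (neg_ne_zero.2 hy0) (by rw [← hx]; exact hx0)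
  have h3 := w.add_min 1 (-x) one_ne_zero (neg_ne_zero.2 hx0) (by rw [← hy]; exact hy0)
  rw [hxy, w.v_one] at h1
  rw [← hx, w.v_one, w.v_neg] at h2
  rw [← hy, w.v_one, w.v_neg] at h3
  exact ⟨h1, h2, h3⟩

/-- the ramification-type divisor -/
noncomputable def RD (H : FFin k K) (S : Finset (FFVal k K)) (x y : K) : FFVal k K →₀ ℤ :=
  zd H x + zd H y + zd H x⁻¹ - ∑ w ∈ S, Finsupp.single w 1

theorem ffdeg_RD (H : FFin k K) (S : Finset (FFVal k K)) {x y : K}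
    (hx : x ∉ Set.range (algebraMap k K)) (hy : y ∉ Set.range (algebraMap k K))
    (hxy : x + y = 1) :
    ffdeg (RD H S x y) = 3 * Module.finrank (IntermediateField.adjoin k {x}) K - S.card := by
  have h1 : ffdeg (∑ w ∈ S, Finsupp.single w (1 : ℤ)) = S.card := by
    classical
    induction S using Finset.induction_on with
    | empty => simp [ffdeg_zero]
    | insert a s ha ih =>
      rw [Finset.sum_insert ha, ffdeg_add, ih, ffdeg_single, Finset.card_insert_of_notMem ha]
      push_cast; ring
  have h2 : ffdeg (zd H y) = Module.finrank (IntermediateField.adjoin k {x}) K := by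
    rw [ffdeg_zd H hy, adj_one_sub hxy]
  rw [RD, ffdeg_sub, ffdeg_add, ffdeg_add, h1, h2, ffdeg_zd H hx, ffdeg_zd_inv H hx]
  ring

open Classical in
theorem RD_apply (H : FFin k K) (S : Finset (FFVal k K)) (x y : K) (w : FFVal k K) :
    RD H S x y w = max 0 (w.v x) + max 0 (w.v y) + max 0 (- w.v x) - if w ∈ S then 1 else 0 := by
  unfold RD
  simp only [Finsupp.coe_sub, Finsupp.coe_add, Pi.sub_apply, Pi.add_apply, zd_apply,
    Finsupp.finsetSum_apply, FFVal.v_inv, Finsupp.single_apply]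
  simp

theorem trace_poly {H : FFin k K} {S : Finset (FFVal k K)} {x y : K}
    (hx : x ∉ Set.range (algebraMap k K)) (hy : y ∉ Set.range (algebraMap k K))
    (hxS : ∀ w : FFVal k K, w ∉ S → w.v x = 0)
    (hyS : ∀ w : FFVal k K, w ∉ S → w.v y = 0)
    (hxy : x + y = 1) {h f : K} {m : ℕ} (hh : h ∈ RRspace k K (RD H S x y))
    (hf : f ∈ VV H x m) :
    ∃ r ∈ degreeLT k (m + 1), algebraMap (IntermediateField.adjoin k {x}) K
      (Algebra.trace (IntermediateField.adjoin k {x}) K (f * h)) = aeval x r := by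
  classical
  have hx0 := notMem_range_ne_zero hx
  have hy0 := notMem_range_ne_zero hy
  have := H x hx
  rw [mem_RR] at hh
  rw [mem_VV] at hf
  have hu := unit_vals (k := k) hx0 hy0 hxy
  set F := IntermediateField.adjoin k {x} with hF
  set Tr : K → K := fun a => algebraMap F K (Algebra.trace F K a) with hTr
  have hTrmul : ∀ (c : F) (a : K), Tr ((c : K) * a) = c * Tr a := by
    intro c a
    have h1 : (c : K) * a = c • a := rfl
    simp only [hTr]
    rw [h1, map_smul, smul_eq_mul, map_mul]; rfl
  have hxF : x ∈ F := IntermediateField.mem_adjoin_simple_self k x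
  have hyF : y ∈ F := by
    rw [show y = 1 - x by linear_combination hxy]; exact sub_mem (one_mem _) hxF
  have bas : ∀ w : FFVal k K, w.Ge (-(RD H S x y w)) h := hh
  simp only [RD_apply] at bas
  -- valuations of u
  have hu0 : ∀ w : FFVal k K, 0 ≤ w.v x → w.Ge (if w ∈ S then 1 else 0) (x * y * (f * h)) := by
    intro w hw
    have := (((FFVal.Ge.self (w := w) x).mul (FFVal.Ge.self y)).mul ((hf.1 w hw).mul (bas w)))
    refine this.mono ?_
    have := hu w
    split_ifs <;> lia
  have hu1 : ∀ w : FFVal k K, w.v x ≠ 0 ∨ w.v y ≠ 0 → w ∈ S := by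
    intro w hw
    by_contra hc
    rcases hw with hw | hw
    · exact hw (hxS w hc)
    · exact hw (hyS w hc)
  obtain ⟨p, hp, hpX⟩ := adj_trace (F := F) (t := x) (f := x * y * (f * h)) hF hx
    (fun w hw => (hu0 w (hw hx0)).mono (by split_ifs <;> lia))
  have hpX := hpX (fun w hw => by
    have h1 := hw hx0
    have := hu0 w (by lia)
    rwa [if_pos (hu1 w (by lia))] at this)
  obtain ⟨q, hq, hqX⟩ := adj_trace (F := F) (t := y) (f := x * y * (f * h))
    (hF.trans (adj_one_sub hxy)) hy
    (fun w hw => (hu0 w (by have := hu w; have := hw hy0; lia)).mono (by split_ifs <;> lia))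
  have hqX := hqX (fun w hw => by
    have h1 := hw hy0
    have := hu0 w (by have := hu w; lia)
    rwa [if_pos (hu1 w (by lia))] at this)
  have hpq : p = q.comp (1 - X) := by
    by_contra hne
    apply aeval_ne hx (sub_ne_zero.2 hne)
    rw [map_sub, aeval_comp, ← hp, hq]
    simp only [map_sub, map_one, aeval_X]
    rw [show 1 - x = y by linear_combination -hxy, sub_self]
  have hpX' : (1 - X : k[X]) ∣ p := by
    rw [hpq]
    obtain ⟨q1, rfl⟩ := hqX
    exact ⟨q1.comp (1 - X), by simp⟩
  have hcop : IsCoprime (X : k[X]) (1 - X) := ⟨1, 1, by ring⟩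
  obtain ⟨r, rfl⟩ := hcop.mul_dvd hpX hpX'
  have hT : Tr (f * h) = aeval x r := by
    have h1 : Tr (x * y * (f * h)) = x * y * Tr (f * h) := by
      exact hTrmul (⟨x, hxF⟩ * ⟨y, hyF⟩) _
    have h2 : Tr (x * y * (f * h)) = aeval x (X * (1 - X) * r) := hp
    rw [h1] at h2
    simp only [map_mul, map_sub, map_one, aeval_X] at h2
    rw [show 1 - x = y by linear_combination -hxy] at h2
    exact mul_left_cancel₀ (mul_ne_zero hx0 hy0) h2
  refine ⟨r, ?_, hT⟩
  by_cases hr : r = 0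
  · rw [hr]; exact zero_mem _
  have hs0 : ∀ w : FFVal k K, w.v x ≤ 0 → w.Ge (if w ∈ S then 1 else 0)
      (y * x⁻¹ ^ (m + 2) * (f * h)) := by
    intro w hw
    have hfw : w.Ge (m * w.v x) f := by
      rcases hw.lt_or_eq with h | h
      · exact_mod_cast hf.2 w h
      · rw [h, mul_zero]; exact hf.1 w h.ge
    have := (((FFVal.Ge.self (w := w) y).mul ((FFVal.Ge.self x⁻¹).pow (m + 2))).mul
      (hfw.mul (bas w)))
    refine this.mono ?_
    have := hu w
    rw [FFVal.v_inv]
    push_cast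
    have e : w.v y + ((m : ℤ) + 2) * -w.v x + (m * w.v x + -(max 0 (w.v x) + max 0 (w.v y) +
      max 0 (-w.v x) - if w ∈ S then 1 else 0)) = w.v y - 2 * w.v x - (max 0 (w.v x) +
      max 0 (w.v y) + max 0 (-w.v x) - if w ∈ S then 1 else 0) := by ring
    rw [e]
    split_ifs <;> lia
  have hxi := inv_notMem_range hx
  obtain ⟨e, he, heX⟩ := adj_trace (F := F) (t := x⁻¹) (f := y * x⁻¹ ^ (m + 2) * (f * h))
    (hF.trans (adj_inv x)) hxi
    (fun w hw => (hs0 w (by have := hw (inv_ne_zero hx0); rw [FFVal.v_inv] at this; lia)).mono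
      (by split_ifs <;> lia))
  have heX := heX (fun w hw => by
    have h1 := hw (inv_ne_zero hx0)
    rw [FFVal.v_inv] at h1
    have := hs0 w (by lia)
    rwa [if_pos (hu1 w (by lia))] at this)
  obtain ⟨e1, rfl⟩ := heX
  have hT2 : aeval x ((1 - X) * r) = x ^ (m + 2) * (x⁻¹ * aeval x⁻¹ e1) := by
    have h1 : Tr (y * x⁻¹ ^ (m + 2) * (f * h)) = y * x⁻¹ ^ (m + 2) * Tr (f * h) :=
      hTrmul (⟨y, hyF⟩ * ⟨x, hxF⟩⁻¹ ^ (m + 2)) _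
    have h2 : Tr (y * x⁻¹ ^ (m + 2) * (f * h)) = aeval x⁻¹ (X * e1) := he
    rw [h1, hT] at h2
    simp only [map_mul, map_sub, map_one, aeval_X] at h2 ⊢
    rw [← h2, show 1 - x = y by linear_combination -hxy]
    rw [inv_pow]; field_simp
  obtain ⟨w, hw⟩ := place_inf H hx
  have hne : (1 - X : k[X]) ≠ 0 := by
    intro h; have := congrArg (coeff · 0) h; simp at this
  have hne' := mul_ne_zero hne hr
  have hge : w.Ge ((m + 2 : ℕ) * w.v x + (w.v x⁻¹ + 0)) (aeval x ((1 - X) * r)) := by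
    rw [hT2]
    refine ((FFVal.Ge.self x).pow _).mul ((FFVal.Ge.self _).mul (FFVal.Ge.aeval ?_ _))
    intro _; rw [FFVal.v_inv]; lia
  have h3 := hge (aeval_ne hx hne')
  have h4 := v_aeval_inf hx0 hw hne'
  have hd : (1 - X : k[X]).natDegree = 1 := by
    rw [show (1 - X : k[X]) = -(X - C 1) by simp, natDegree_neg, natDegree_X_sub_C]
  rw [natDegree_mul hne hr, hd] at h4
  rw [FFVal.v_inv] at h3
  have h5 := h3.trans h4
  have h6 : (r.natDegree : ℤ) ≤ m := by
    push_cast at h5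
    by_contra hc
    push Not at hc
    nlinarith
  rw [mem_degreeLT]
  rw [degree_eq_natDegree hr]
  exact_mod_cast (show r.natDegree < m + 1 by lia)

theorem ell_RD {H : FFin k K} {S : Finset (FFVal k K)} {x y : K}
    (hx : x ∉ Set.range (algebraMap k K)) (hy : y ∉ Set.range (algebraMap k K))
    (hxS : ∀ w : FFVal k K, w ∉ S → w.v x = 0)
    (hyS : ∀ w : FFVal k K, w ∉ S → w.v y = 0)
    (hxy : x + y = 1)
    {ι : Type} [Fintype ι] {f : ι → K} {m : ι → ℕ} (h : Red H x f m)
    (hcard : Fintype.card ι = Module.finrank (IntermediateField.adjoin k {x}) K) :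
    Module.finrank k (RRspace k K (RD H S x y)) ≤ ∑ i, (m i + 1) := by
  have := fun i => finite_degreeLT (k := k) (m i + 1)
  have := H x hx
  have hne : Nonempty ι := by
    rw [← Fintype.card_pos_iff, hcard]; exact Module.finrank_pos
  set F := IntermediateField.adjoin k {x} with hF
  let tr : K →ₗ[k] F := (Algebra.trace F K).restrictScalars k
  let T : K →ₗ[k] (ι → K) := LinearMap.pi (fun i =>
    F.val.toLinearMap ∘ₗ tr ∘ₗ (LinearMap.mulLeft k (f i)))
  have hT : ∀ a i, T a i = algebraMap F K (Algebra.trace F K (f i * a)) := fun a i => rfl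
  let Ψ : (∀ i, degreeLT k (m i + 1)) →ₗ[k] (ι → K) := LinearMap.pi (fun i =>
    (aeval x).toLinearMap ∘ₗ (degreeLT k (m i + 1)).subtype ∘ₗ LinearMap.proj i)
  have hΨ : ∀ p i, Ψ p i = aeval x (p i : k[X]) := fun p i => rfl
  have hinj : Function.Injective T := by
    rw [injective_iff_map_eq_zero]
    intro a ha
    let b := basisOfLinearIndependentOfCardEqFinrank h.li hcard
    have hb : ∀ i, b i = f i := fun i => by
      simp [b]
    have hnd := traceForm_nondegenerate F K
    apply hnd.1 a
    intro c
    have h0 : Algebra.traceForm F K a = 0 := by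
      apply b.ext
      intro i
      rw [hb, Algebra.traceForm_apply, LinearMap.zero_apply, mul_comm]
      have := congrFun ha i
      rw [hT] at this
      exact (algebraMap F K).injective (by simpa using this)
    rw [h0, LinearMap.zero_apply]
  have hle : (RRspace k K (RD H S x y)).map T ≤ LinearMap.range Ψ := by
    rintro _ ⟨a, ha, rfl⟩
    choose r hr hr' using fun i => trace_poly hx hy hxS hyS hxy ha (h.mem i)
    refine ⟨fun i => ⟨r i, hr i⟩, ?_⟩
    funext i
    rw [hΨ, hT, hr']
  calc Module.finrank k (RRspace k K (RD H S x y))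
      = Module.finrank k ((RRspace k K (RD H S x y)).map T) :=
        (Submodule.equivMapOfInjective T hinj _).finrank_eq
    _ ≤ Module.finrank k (LinearMap.range Ψ) := Submodule.finrank_mono hle
    _ ≤ Module.finrank k (∀ i, degreeLT k (m i + 1)) := LinearMap.finrank_range_le Ψ
    _ = _ := finrank_dom _

theorem mason_aux (H : FFin k K) (S : Finset (FFVal k K)) {x y : K}
    (hx : x ∉ Set.range (algebraMap k K)) (hy : y ∉ Set.range (algebraMap k K))
    (hxS : ∀ w : FFVal k K, w ∉ S → w.v x = 0)
    (hyS : ∀ w : FFVal k K, w ∉ S → w.v y = 0)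
    (hxy : x + y = 1) :
    max (ffHeight k x) (ffHeight k y) ≤ (S.card : ℤ) + 2 * ffGenus k K - 2 := by
  obtain ⟨f, m, h⟩ := red_exists H hx
  have hcard := Fintype.card_fin (Module.finrank (IntermediateField.adjoin k {x}) K)
  have h1 := genus_ge hx h hcard (RD H S x y)
  have h2 := genus_ge_one hx h hcard
  have h3 := ell_RD hx hy hxS hyS hxy h hcard
  rw [ffdeg_RD H S hx hy hxy] at h1
  rw [Finset.sum_add_distrib, Finset.sum_const, Finset.card_univ, hcard] at h3
  rw [ffHeight_eq H, ffHeight_eq H, ffdeg_zd_inv H hx, ffdeg_zd_inv H hy, ← adj_one_sub hxy,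
    max_self]
  zify at h3
  simp only [smul_eq_mul, mul_one] at h3
  lia

end Trace

/-- Mason: Let `k` be an algebraically closed field of characteristic
`0`, `K` a finite extension of `k(z)` of genus `g`, and `S` a finite set of valuations
of `K/k`.  Every solution of `x + y = 1` in `S`-units `x, y ∉ k^*` satisfies
`max(H_K(x), H_K(y)) ≤ |S| + 2g - 2`. -/
theorem stmt_19 (k K : Type*) [Field k] [IsAlgClosed k] [CharZero k] [Field K]
    [Algebra (RatFunc k) K] [FiniteDimensional (RatFunc k) K]
    [Algebra k K] [IsScalarTower k (RatFunc k) K]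
    (S : Finset (FFVal k K)) (x y : K)
    (hx0 : x ≠ 0) (hy0 : y ≠ 0)
    (hxS : ∀ w : FFVal k K, w ∉ S → w.v x = 0)
    (hyS : ∀ w : FFVal k K, w ∉ S → w.v y = 0)
    (hxk : x ∉ Set.range (algebraMap k K))
    (hyk : y ∉ Set.range (algebraMap k K))
    (hxy : x + y = 1) :
    max (ffHeight k x) (ffHeight k y) ≤ (S.card : ℤ) + 2 * ffGenus k K - 2 := by
  exact mason_aux (fun t ht => ff_finite ht) S hxk hyk hxS hyS hxy
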